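/- arXiv:2006.11173 — 6 statements merged into one kernel-verified Lean document; each statement's English description precedes it below -/
import Mathlib

section
/- Let p be a prime, G a finite group, and N a normal subgroup of G whose index [G:N] is a power of p. Then the ℤ-linear map ζ_G : ℤ[G] → ℤ[G] determined on group elements by ζ_G(g) = g_p · g_{p'}^p maps the fixed-point subring (ℤ[G])^N = {a ∈ ℤ[G] : n a n⁻¹ = a for all n ∈ N} bijectively onto itself, and its restriction to (ℤ[G])^N is a ring automorphism of (ℤ[G])^N. -/
theorem zz_powhom {Γ : Type*} [Group Γ] {H : Type*} [Group H] [Finite H] (f : Γ →* H)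
    (hk : f.ker ≤ Subgroup.center Γ) (q : ℕ) (hq : 1 ≤ q) (hd : Nat.card H ∣ q - 1) (x y : Γ) :
    (x * y) ^ q = x ^ q * y ^ q := by
  have hker : f.ker.index ∣ Nat.card H := by
    rw [Subgroup.index_ker]; exact Subgroup.card_subgroup_dvd_card _
  have hc : (Subgroup.center Γ).index ∣ q - 1 :=
    ((Subgroup.index_dvd_of_le hk).trans hker).trans hd
  have : (Subgroup.center Γ).FiniteIndex := by
    constructor
    intro h0
    have := (Subgroup.index_dvd_of_le hk).trans hker
    rw [h0] at this
    exact Nat.card_pos.ne' (Nat.eq_zero_of_zero_dvd this)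
  obtain ⟨t, ht⟩ := hc
  have hq' : q = (Subgroup.center Γ).index * t + 1 := by omega
  have h1 : (x * y) ^ (Subgroup.center Γ).index
      = x ^ (Subgroup.center Γ).index * y ^ (Subgroup.center Γ).index := by
    have := congrArg Subtype.val (map_mul (MonoidHom.transferCenterPow Γ) x y)
    exact this
  have hx : ∀ z : Γ, ∀ w, Commute (z ^ (Subgroup.center Γ).index) w := fun z w =>
    ((Subgroup.mem_center_iff.1 ((Subgroup.center Γ).pow_index_mem z)) w).symm
  rw [hq', pow_succ, pow_succ, pow_succ, pow_mul, h1, (hx x _).mul_pow, ← pow_mul, ← pow_mul]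
  have h2 : Commute (y ^ ((Subgroup.center Γ).index * t)) x := by
    rw [pow_mul]; exact (hx y x).pow_left t
  simp only [mul_assoc]
  rw [← mul_assoc _ x y, h2.eq, mul_assoc]

theorem zz_graded {R : Type*} [Ring R] {H : Type*} [Group H] [Finite H] (B : H → AddSubgroup R)
    (h1 : (1 : R) ∈ B 1) (hmul : ∀ c d x y, x ∈ B c → y ∈ B d → x * y ∈ B (c * d))
    (hcent : ∀ c x y, x ∈ B 1 → y ∈ B c → x * y = y * x)
    (q : ℕ) (hq : 1 ≤ q) (hd : Nat.card H ∣ q - 1)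
    (M : ℕ) (hM : 1 ≤ M) (hMd : Nat.card H ∣ M) (c d : H) (x y : R) (hx : x ∈ B c) (hy : y ∈ B d)
    (hxM : x ^ (M + 1) = x) (hyM : y ^ (M + 1) = y) : (x * y) ^ q = x ^ q * y ^ q := by
  have hpow : ∀ c x (n : ℕ), x ∈ B c → x ^ n ∈ B (c ^ n) := by
    intro c x n hx
    induction n with
    | zero => simpa using h1
    | succ n ih => rw [pow_succ, pow_succ]; exact hmul _ _ _ _ ih hx
  have hHM : ∀ c : H, c ^ M = 1 := fun c => by
    obtain ⟨t, rfl⟩ := hMd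
    rw [pow_mul, pow_card_eq_one', one_pow]
  set e := x ^ M * y ^ M with he
  have hxM1 : x ^ M ∈ B 1 := by simpa [hHM] using hpow c x M hx
  have hyM1 : y ^ M ∈ B 1 := by simpa [hHM] using hpow d y M hy
  have he1 : e ∈ B 1 := by simpa using hmul _ _ _ _ hxM1 hyM1
  have hec : ∀ c x, x ∈ B c → e * x = x * e := fun c x hx => hcent c e x he1 hx
  have idp : ∀ x : R, x ^ (M + 1) = x → x ^ M * x ^ M = x ^ M := by
    intro x h
    obtain ⟨m, rfl⟩ : ∃ m, M = m + 1 := ⟨M - 1, by omega⟩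
    calc x ^ (m + 1) * x ^ (m + 1) = x ^ (m + 1 + 1) * x ^ m := by
          rw [← pow_add, ← pow_add]; congr 1; omega
      _ = x ^ (m + 1) := by rw [h, ← pow_succ']
  have hee : e * e = e := by
    have := hcent 1 _ _ hyM1 hxM1
    calc e * e = x ^ M * (y ^ M * x ^ M) * y ^ M := by rw [he]; noncomm_ring
      _ = (x ^ M * x ^ M) * (y ^ M * y ^ M) := by rw [this]; noncomm_ring
      _ = e := by rw [idp x hxM, idp y hyM]
  let Γ : Subgroup (Rˣ × H) :=
    { carrier := {u | (u.1 : R) * e ∈ B u.2 ∧ ((u.1⁻¹ : Rˣ) : R) * e ∈ B u.2⁻¹ ∧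
        (u.1 : R) * e = e * u.1 ∧ (u.1 : R) * (1 - e) = 1 - e}
      one_mem' := by simp [he1]
      mul_mem' := by
        rintro ⟨u, c⟩ ⟨v, d⟩ ⟨h1, h2, h3, h4⟩ ⟨k1, k2, k3, k4⟩
        simp only at h1 h2 h3 h4 k1 k2 k3 k4
        have hi : ∀ u : Rˣ, (u : R) * e = e * u → ((u⁻¹ : Rˣ) : R) * e = e * ((u⁻¹ : Rˣ) : R) := by
          intro u hu
          exact ((show Commute (u : R) e from hu).units_inv_left).eq
        refine ⟨?_, ?_, ?_, ?_⟩
        · have := hmul _ _ _ _ h1 k1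
          convert this using 1
          simp only [Prod.mk_mul_mk, Units.val_mul]
          calc (u : R) * v * e = u * (v * (e * e)) := by rw [hee]; noncomm_ring
            _ = u * ((v * e) * e) := by noncomm_ring
            _ = _ := by rw [k3]; simp only [mul_assoc]; rw [← k3, ]
        · have := hmul _ _ _ _ k2 h2
          simp only [Prod.mk_mul_mk, mul_inv_rev, Units.val_mul]
          convert this using 1
          calc ((v⁻¹ : Rˣ) : R) * ((u⁻¹ : Rˣ) : R) * e
              = ((v⁻¹ : Rˣ) : R) * (((u⁻¹ : Rˣ) : R) * (e * e)) := by rw [hee]; noncomm_ring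
            _ = ((v⁻¹ : Rˣ) : R) * ((((u⁻¹ : Rˣ) : R) * e) * e) := by noncomm_ring
            _ = _ := by rw [hi u h3]; simp only [mul_assoc]; rw [← hi u h3]
        · simp only [Prod.mk_mul_mk, Units.val_mul]
          rw [mul_assoc, k3, ← mul_assoc, h3, mul_assoc]
        · simp only [Prod.mk_mul_mk, Units.val_mul]
          rw [mul_assoc, k4, h4]
      inv_mem' := by
        rintro ⟨u, c⟩ ⟨h1, h2, h3, h4⟩
        simp only at h1 h2 h3 h4
        refine ⟨h2, by simpa using h1, ((show Commute (u : R) e from h3).units_inv_left).eq, ?_⟩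
        simp only [Prod.inv_mk]
        rw [Units.inv_mul_eq_iff_eq_mul, h4] }
  have hdec : ∀ u : Γ, ((u.1.1 : Rˣ) : R) = u.1.1 * e + (1 - e) := by
    rintro ⟨⟨u, c⟩, h1, h2, h3, h4⟩
    simp only at h1 h2 h3 h4 ⊢
    rw [← h4]; noncomm_ring
  have hlift : ∀ c x, x ∈ B c → x ^ M * e = e → ∃ u : Γ, ((u.1.1 : Rˣ) : R) = x * e + (1 - e) := by
    intro c x hx hxe
    have hxc := hec c x hx
    obtain ⟨m, rfl⟩ : ∃ m, M = m + 1 := ⟨M - 1, by omega⟩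
    have hmc := hec _ _ (hpow c x m hx)
    have key : ∀ a b : R, e * a = a * e → e * b = b * e → a * b * e = e →
        (a * e + (1 - e)) * (b * e + (1 - e)) = 1 := by
      intro a b ha hb hab
      have : a * e * (b * e) = e := by
        rw [mul_assoc, ← mul_assoc e b e, hb, mul_assoc b, hee, ← mul_assoc, hab]
      have h2 : e * (b * e) = b * e := by rw [← mul_assoc, hb, mul_assoc, hee]
      calc _ = a * e * (b * e) + (a * e - a * (e * e)) + (b * e - e * (b * e)) + 
            (1 - e - e + e * e) := by noncomm_ring
        _ = 1 := by rw [this, h2, hee]; noncomm_ring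
    have mule : ∀ a : R, (a * e + (1 - e)) * e = a * e := by
      intro a
      calc _ = a * (e * e) + (e - e * e) := by noncomm_ring
        _ = _ := by rw [hee]; simp
    let U : Rˣ := ⟨x * e + (1 - e), x ^ m * e + (1 - e),
      key _ _ hxc hmc (by rw [← pow_succ', hxe]), key _ _ hmc hxc (by rw [← pow_succ, hxe])⟩
    refine ⟨⟨(U, c), ?_, ?_, ?_, ?_⟩, rfl⟩
    · change (x * e + (1 - e)) * e ∈ B c
      rw [mule]; simpa using hmul _ _ _ _ hx he1
    · change (x ^ m * e + (1 - e)) * e ∈ B c⁻¹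
      rw [mule]
      have : c⁻¹ = c ^ m := by
        rw [inv_eq_iff_mul_eq_one, ← pow_succ']; exact hHM c
      rw [this]
      simpa using hmul _ _ _ _ (hpow c x m hx) he1
    · change (x * e + (1 - e)) * e = e * (x * e + (1 - e))
      have t : e * (x * e) = x * e := by rw [← mul_assoc, hxc, mul_assoc x, hee]
      rw [mule, mul_add, t, mul_sub, hee]; simp
    · change (x * e + (1 - e)) * (1 - e) = 1 - e
      rw [mul_sub, mule]; noncomm_ring
  let f : Γ →* H := (MonoidHom.snd Rˣ H).comp Γ.subtype
  have hk : f.ker ≤ Subgroup.center Γ := by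
    intro u hu
    have hu1 : u.1.2 = 1 := hu
    rw [Subgroup.mem_center_iff]
    intro v
    have hB : ((u.1.1 : Rˣ) : R) * e ∈ B 1 := by rw [← hu1]; exact u.2.1
    have hC := hcent _ _ _ hB v.2.1
    have hu3 := u.2.2.2.1
    have hv3 := v.2.2.2.1
    apply Subtype.ext
    apply Prod.ext
    · apply Units.ext
      change ((v.1.1 : Rˣ) : R) * u.1.1 = u.1.1 * v.1.1
      rw [hdec u, hdec v]
      have a1 : e * (((v.1.1 : Rˣ) : R) * e) = v.1.1 * e := by rw [← mul_assoc, ← hv3, mul_assoc, hee]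
      have a2 : e * (((u.1.1 : Rˣ) : R) * e) = u.1.1 * e := by rw [← mul_assoc, ← hu3, mul_assoc, hee]
      have a3 : (((v.1.1 : Rˣ) : R) * e) * e = v.1.1 * e := by rw [mul_assoc, hee]
      have a4 : (((u.1.1 : Rˣ) : R) * e) * e = u.1.1 * e := by rw [mul_assoc, hee]
      simp only [mul_add, add_mul, mul_sub, sub_mul, mul_one, one_mul, a1, a2, a3, a4, hee, hC]
      abel
    · change v.1.2 * u.1.2 = u.1.2 * v.1.2
      rw [hu1]; simp
  have hexe : x ^ M * e = e := by rw [he, ← mul_assoc, idp x hxM]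
  have heye : y ^ M * e = e := by
    rw [he, ← mul_assoc, hcent 1 _ _ hyM1 hxM1, mul_assoc, idp y hyM]
  obtain ⟨X, hX⟩ := hlift c x hx hexe
  obtain ⟨Y, hY⟩ := hlift d y hy heye
  have main := zz_powhom f hk q hq hd X Y
  have main' : (((X.1.1 : Rˣ) : R) * Y.1.1) ^ q = ((X.1.1 : Rˣ) : R) ^ q * ((Y.1.1 : Rˣ) : R) ^ q := by
    have := congrArg (fun u : Γ => ((u.1.1 : Rˣ) : R)) main
    simpa using this
  have hXe : ((X.1.1 : Rˣ) : R) * e = x * e := by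
    rw [hX]
    calc _ = x * (e * e) + (e - e * e) := by noncomm_ring
        _ = _ := by rw [hee]; simp
  have hYe : ((Y.1.1 : Rˣ) : R) * e = y * e := by
    rw [hY]
    calc _ = y * (e * e) + (e - e * e) := by noncomm_ring
        _ = _ := by rw [hee]; simp
  have cX : e * ((X.1.1 : Rˣ) : R) = X.1.1 * e := X.2.2.2.1.symm
  have cY : e * ((Y.1.1 : Rˣ) : R) = Y.1.1 * e := Y.2.2.2.1.symm
  have cx := hec c x hx
  have cy := hec d y hy
  have pe : ∀ (a b : R), e * a = a * e → e * b = b * e → a * e = b * e → ∀ n : ℕ,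
      a ^ n * e = b ^ n * e := by
    intro a b ha hb hab n
    induction n with
    | zero => simp
    | succ n ih => rw [pow_succ, mul_assoc, hab, ← hb, ← mul_assoc, ih, mul_assoc, hb, ← mul_assoc,
        ← pow_succ]
  have pm : ∀ (a b a' b' : R), e * b = b * e → e * b' = b' * e → a * e = a' * e → b * e = b' * e →
      a * b * e = a' * b' * e := by
    intro a b a' b' hb hb' h1 h2
    rw [mul_assoc, h2, ← hb', ← mul_assoc, h1, mul_assoc, hb', mul_assoc]
  have cm : ∀ a b : R, e * a = a * e → e * b = b * e → e * (a * b) = a * b * e := by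
    intro a b ha hb
    exact (Commute.mul_right (show Commute e a from ha) (show Commute e b from hb)).eq
  have cp : ∀ (a : R) (n : ℕ), e * a = a * e → e * a ^ n = a ^ n * e := by
    intro a n ha
    exact (Commute.pow_right (show Commute e a from ha) n).eq
  have fin : (x * y) ^ q * e = x ^ q * y ^ q * e := by
    rw [← pe _ _ (cm _ _ cX cY) (cm _ _ cx cy) (pm _ _ _ _ cY cy hXe hYe) q, main']
    exact pm _ _ _ _ (cp _ _ cY) (cp _ _ cy) (pe _ _ cX cx hXe q) (pe _ _ cY cy hYe q)
  have hxye : x * y * e = x * y := by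
    have t1 : y * (x ^ M * y ^ M) = x ^ M * y := by
      rw [← mul_assoc, ← hcent d _ _ hxM1 hy, mul_assoc, ← pow_succ', hyM]
    rw [he, mul_assoc, t1, ← mul_assoc, ← pow_succ', hxM]
  have hxqye : x ^ q * y ^ q * e = x ^ q * y ^ q := by
    obtain ⟨m, rfl⟩ : ∃ m, q = m + 1 := ⟨q - 1, by omega⟩
    have : x ^ (m + 1) * y ^ (m + 1) * e = x ^ m * (x * e) * (y ^ m * (y * e)) := by
      rw [← cx]
      have := cp y m cy
      calc _ = x ^ m * x * (y ^ m * y * (e * e)) := by rw [hee]; simp only [pow_succ, mul_assoc]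
        _ = x ^ m * x * (y ^ m * (e * y) * e) := by rw [cy]; simp only [mul_assoc]
        _ = x ^ m * x * ((e * y ^ m) * y * e) := by rw [this]; simp only [mul_assoc]
        _ = x ^ m * (x * e) * (y ^ m * (y * e)) := by simp only [mul_assoc]
        _ = _ := by rw [cx]
    have t1 : y * (x ^ M * y ^ M) = x ^ M * y := by
      rw [← mul_assoc, ← hcent d _ _ hxM1 hy, mul_assoc, ← pow_succ', hyM]
    have t2 : y ^ (m + 1) * (x ^ M * y ^ M) = x ^ M * y ^ (m + 1) := by
      rw [pow_succ, mul_assoc, t1, ← mul_assoc,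
        ← hcent _ _ _ hxM1 (hpow d y m hy), mul_assoc]
    rw [he, mul_assoc, t2, ← mul_assoc, pow_succ, mul_assoc (x ^ m), ← pow_succ', hxM]
  have hxyq : (x * y) ^ q * e = (x * y) ^ q := by
    obtain ⟨m, rfl⟩ : ∃ m, q = m + 1 := ⟨q - 1, by omega⟩
    rw [pow_succ, mul_assoc, hxye]
  rw [← hxyq, fin, hxqye]

theorem zz_orbit {α : Type*} [Fintype α] [DecidableEq α] (q : ℕ) [hq : Fact q.Prime]
    (σ : α → α) (hσ : (show Function.End α from σ) ^ q = 1) (w : α → ZMod q) (hw : ∀ a, w (σ a) = w a) :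
    ∑ a, w a = ∑ a with σ a = a, w a := by
  classical
  rw [← Finset.sum_fiberwise (s := Finset.univ) (g := w), 
    ← Finset.sum_fiberwise (s := Finset.univ.filter fun a => σ a = a) (g := w)]
  refine Finset.sum_congr rfl fun v _ => ?_
  rw [Finset.sum_congr rfl (g := fun _ => v) (by simp), Finset.sum_const,
    Finset.sum_congr rfl (g := fun _ => v) (by simp), Finset.sum_const]
  let τ : Function.End {a // w a = v} := fun a => ⟨σ a.1, by rw [hw]; exact a.2⟩
  have hτn : ∀ n : ℕ, ∀ a, ((τ ^ n) a).1 = ((show Function.End α from σ) ^ n) a.1 := by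
    intro n
    induction n with
    | zero => intro a; rfl
    | succ n ih => intro a; rw [pow_succ, pow_succ]; exact ih (τ a)
  have hτ : τ ^ q ^ 1 = 1 := by
    rw [pow_one]
    funext a
    apply Subtype.ext
    rw [hτn, hσ]; rfl
  have := Equiv.Perm.card_fixedPoints_modEq hτ
  have h2 := (ZMod.natCast_eq_natCast_iff _ _ _).2 this
  rw [Fintype.card_subtype] at h2
  have h3 : Fintype.card (Function.fixedPoints τ) = 
      (Finset.filter (fun a => w a = v) (Finset.univ.filter fun a => σ a = a)).card := by
    rw [← Fintype.card_coe]
    refine Fintype.card_congr 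
      { toFun := fun a => ⟨a.1.1, by
          have := congrArg Subtype.val a.2
          simpa using ⟨this, a.1.2⟩⟩
        invFun := fun a => ⟨⟨a.1, (Finset.mem_filter.1 a.2).2⟩, 
          Subtype.ext (Finset.mem_filter.1 (Finset.mem_filter.1 a.2).1).2⟩
        left_inv := fun a => rfl
        right_inv := fun a => rfl }
  rw [h3] at h2
  simp only [nsmul_eq_mul]
  rw [h2]

theorem zz_eq_sum {k G : Type*} [CommRing k] [Fintype G] (x : MonoidAlgebra k G) :
    x = ∑ g, MonoidAlgebra.single g (x.coeff g) := by
  classical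
  ext g
  simp [MonoidAlgebra.coeff_sum, Finsupp.single_apply]

theorem zz_expand {k G : Type*} [CommRing k] [Group G] [Fintype G] (x : MonoidAlgebra k G) (m : ℕ) :
    x ^ m = ∑ f : Fin m → G, MonoidAlgebra.single (List.ofFn f).prod (∏ i, x.coeff (f i)) := by
  induction m with
  | zero => simp [MonoidAlgebra.one_def]
  | succ m ih =>
    rw [pow_succ', ih]
    conv_lhs => rw [zz_eq_sum x]
    rw [← (Fin.consEquiv (fun _ => G)).sum_comp, Fintype.sum_prod_type, Finset.sum_mul_sum]
    refine Finset.sum_congr rfl fun g _ => Finset.sum_congr rfl fun f _ => ?_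
    rw [MonoidAlgebra.single_mul_single]
    simp [Fin.consEquiv, Fin.prod_univ_succ, ← zz_eq_sum, List.ofFn_succ]

theorem zz_rot {G : Type*} [Group G] (m : ℕ) (f : Fin (m + 1) → G) :
    (List.ofFn (fun i => f (i + 1))).prod = (f 0)⁻¹ * (List.ofFn f).prod * f 0 := by
  rw [List.ofFn_succ', List.ofFn_succ (f := f)]
  simp [List.concat_eq_append]

/-- weighted sums -/
def zzL {k G : Type*} [CommRing k] [Fintype G] (t : G → k) : MonoidAlgebra k G →+ k where
  toFun x := ∑ g, x.coeff g * t g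
  map_zero' := by simp
  map_add' x y := by simp [add_mul, Finset.sum_add_distrib]

theorem zzL_single {k G : Type*} [CommRing k] [Fintype G] (t : G → k) (g : G) (r : k) :
    zzL t (MonoidAlgebra.single g r) = r * t g := by
  classical
  simp [zzL, Finsupp.single_apply]

theorem zz_pair {G : Type*} [Group G] [Fintype G] (N : Subgroup G) [N.Normal] (q : ℕ)
    [hq : Fact q.Prime] (hqN : N.index ∣ q - 1) (c : G ⧸ N) (x : MonoidAlgebra (ZMod q) G)
    (hx : ∀ g, x.coeff g ≠ 0 → (g : G ⧸ N) = c) (t : G → ZMod q)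
    (ht : ∀ n ∈ N, ∀ g, t (n⁻¹ * g * n) = t g) :
    zzL t (x ^ q) = ∑ g, x.coeff g * t (g ^ q) := by
  classical
  obtain ⟨m, hm⟩ : ∃ m, q = m + 1 := ⟨q - 1, by have := hq.out.pos; omega⟩
  rw [zz_expand, map_sum]
  simp only [zzL_single]
  have key : ∀ (r : ℕ), r = q → ∑ f : Fin r → G, (∏ i, x.coeff (f i)) * t (List.ofFn f).prod
      = ∑ g, x.coeff g * t (g ^ q) := by
    intro r hr
    rw [hm] at hr
    subst hr
    let σ : Function.End (Fin (m + 1) → G) := fun f i => f (i + 1)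
    have hσn : ∀ (n : ℕ) f i, (σ ^ n) f i = f (i + n • (1 : Fin (m + 1))) := by
      intro n
      induction n with
      | zero => intro f i; rw [zero_nsmul, add_zero]; rfl
      | succ n ih =>
        intro f i
        rw [pow_succ]
        change (σ ^ n) (σ f) i = _
        rw [ih]
        change f _ = f _
        rw [succ_nsmul, add_assoc]
    have hσ : σ ^ q = 1 := by
      funext f i
      have h1 : (m + 1) • (1 : Fin (m + 1)) = 0 := by
        simpa using card_nsmul_eq_zero (x := (1 : Fin (m + 1)))
      rw [hσn, hm, h1, add_zero]; rfl
    rw [zz_orbit q σ hσ]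
    · symm
      refine Finset.sum_bij (fun g _ => fun _ => g) ?_ ?_ ?_ ?_
      · intro g _
        simp [σ]
      · intro a _ b _ h
        exact congrFun h 0
      · intro f hf
        simp only [Finset.mem_filter, Finset.mem_univ, true_and] at hf
        refine ⟨f 0, Finset.mem_univ _, ?_⟩
        funext i
        induction i using Fin.induction with
        | zero => rfl
        | succ i ih =>
          rw [ih]
          have := congrFun hf i.castSucc
          rw [← this]
          change f (i.castSucc + 1) = _
          rw [Fin.coeSucc_eq_succ]
      · intro g _
        simp only [Finset.prod_const, Finset.card_univ, Fintype.card_fin, List.ofFn_const,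
          List.prod_replicate]
        rw [← hm, ZMod.pow_card]
    · intro f
      have hp : ∏ i, x.coeff (σ f i) = ∏ i, x.coeff (f i) :=
        Equiv.prod_comp (Equiv.addRight (1 : Fin (m + 1))) (fun i => x.coeff (f i))
      rw [hp]
      by_cases h0 : ∏ i, x.coeff (f i) = 0
      · simp [h0]
      congr 1
      have hne : ∀ i, (f i : G ⧸ N) = c := by
        intro i
        apply hx
        intro h
        exact h0 (Finset.prod_eq_zero (Finset.mem_univ i) h)
      have hP : (((List.ofFn f).prod : G) : G ⧸ N) = c := by
        have h1 : (((List.ofFn f).prod : G) : G ⧸ N) = c ^ (m + 1) := by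
          rw [← QuotientGroup.mk'_apply, map_list_prod, List.map_ofFn]
          have : (⇑(QuotientGroup.mk' N) ∘ f) = fun _ => c := funext hne
          rw [this, List.ofFn_const, List.prod_replicate]
        rw [h1]
        obtain ⟨s, hs⟩ := hqN
        have : m = N.index * s := by omega
        rw [pow_succ, this, pow_mul, Subgroup.index_eq_card, pow_card_eq_one', one_pow, one_mul]
      have hn : (List.ofFn f).prod⁻¹ * f 0 ∈ N := by
        rw [← QuotientGroup.eq, hP, hne]
      change t (List.ofFn (fun i => f (i + 1))).prod = _
      rw [zz_rot, ← ht _ hn (List.ofFn f).prod]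
      congr 1
      generalize (List.ofFn f).prod = P
      group
  exact key q rfl

theorem zz_frob {G : Type*} [Group G] [Fintype G] (N : Subgroup G) [N.Normal] (q : ℕ)
    [hq : Fact q.Prime] (hqN : N.index ∣ q - 1) (hqG : ¬ q ∣ Nat.card G)
    (c : G ⧸ N) (x : MonoidAlgebra (ZMod q) G)
    (hx : ∀ g, x.coeff g ≠ 0 → (g : G ⧸ N) = c)
    (hinv : ∀ n ∈ N, ∀ g, (x ^ q).coeff (n⁻¹ * g * n) = (x ^ q).coeff g)
    (hinv' : ∀ n ∈ N, ∀ g, (MonoidAlgebra.mapDomain (· ^ q) x).coeff (n⁻¹ * g * n) =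
      (MonoidAlgebra.mapDomain (· ^ q) x).coeff g) :
    x ^ q = MonoidAlgebra.mapDomain (· ^ q) x := by
  classical
  have hL : ∀ t : G → ZMod q, zzL t (MonoidAlgebra.mapDomain (· ^ q) x) 
      = ∑ g, x.coeff g * t (g ^ q) := by
    intro t
    conv_lhs => rw [zz_eq_sum x]
    have : ∀ s : Finset G, MonoidAlgebra.mapDomain (· ^ q) (∑ g ∈ s, MonoidAlgebra.single g (x.coeff g))
        = ∑ g ∈ s, MonoidAlgebra.single (g ^ q) (x.coeff g) := by
      intro s
      induction s using Finset.induction_on with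
      | empty => simp
      | insert a s ha ih => rw [Finset.sum_insert ha, Finset.sum_insert ha, MonoidAlgebra.mapDomain_add, ih, MonoidAlgebra.mapDomain_single]
    rw [this, map_sum]
    simp [zzL_single]
  ext h
  let t : G → ZMod q := fun g => ∑ n : N, if g = (n : G)⁻¹ * h * n then 1 else 0
  have ht : ∀ n ∈ N, ∀ g, t (n⁻¹ * g * n) = t g := by
    intro n hn g
    simp only [t]
    rw [← Equiv.sum_comp (Equiv.mulRight (⟨n, hn⟩ : N))]
    refine Finset.sum_congr rfl fun n' _ => ?_
    congr 1
    simp only [Equiv.coe_mulRight, Subgroup.coe_mul, mul_inv_rev, eq_iff_iff]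
    constructor
    · intro h
      simp only [mul_assoc] at h
      have := mul_left_cancel h
      simp only [← mul_assoc] at this
      simpa [mul_assoc] using mul_right_cancel this
    · rintro rfl; group
  have hev : ∀ z : MonoidAlgebra (ZMod q) G, (∀ n ∈ N, ∀ g, z.coeff (n⁻¹ * g * n) = z.coeff g) →
      zzL t z = (Nat.card N : ZMod q) * z.coeff h := by
    intro z hz
    change ∑ g, z.coeff g * t g = _
    simp only [t, Finset.mul_sum]
    rw [Finset.sum_comm]
    simp only [mul_ite, mul_one, mul_zero, Finset.sum_ite_eq', Finset.mem_univ, if_true]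
    rw [Finset.sum_congr rfl (g := fun _ => z.coeff h) (fun (n : N) _ => hz n n.2 h)]
    simp [Nat.card_eq_fintype_card]
  have e1 := hev _ hinv
  have e2 := hev _ hinv'
  rw [zz_pair N q hqN c x hx t ht] at e1
  rw [hL] at e2
  have hu : (Nat.card N : ZMod q) ≠ 0 := by
    rw [Ne, ZMod.natCast_eq_zero_iff]
    exact fun hh => hqG (hh.trans (Subgroup.card_subgroup_dvd_card N))
  exact mul_left_cancel₀ hu (e1.symm.trans e2)

theorem zz_psi_sum {k G : Type*} [CommRing k] (φ : G → G) {ι : Type*} (s : Finset ι)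
    (f : ι → MonoidAlgebra k G) :
    MonoidAlgebra.mapDomain φ (∑ i ∈ s, f i) = ∑ i ∈ s, MonoidAlgebra.mapDomain φ (f i) := by
  classical
  induction s using Finset.induction_on with
  | empty => simp
  | insert a s ha ih => rw [Finset.sum_insert ha, Finset.sum_insert ha, MonoidAlgebra.mapDomain_add, ih]

theorem zz_psi_conj {k G : Type*} [CommRing k] [Group G] (q : ℕ) (n : G) (x : MonoidAlgebra k G) :
    MonoidAlgebra.mapDomain (· ^ q) (MonoidAlgebra.of k G n * x * MonoidAlgebra.of k G n⁻¹)
     = MonoidAlgebra.of k G n * MonoidAlgebra.mapDomain (· ^ q) x * MonoidAlgebra.of k G n⁻¹ := by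
  induction x using MonoidAlgebra.induction_linear with
  | zero => simp
  | add x y hx hy => simp only [mul_add, add_mul, MonoidAlgebra.mapDomain_add, hx, hy]
  | single g r =>
    simp [MonoidAlgebra.of_apply, MonoidAlgebra.single_mul_single, MonoidAlgebra.mapDomain_single,
      conj_pow]

theorem zz_conj_iff {k G : Type*} [CommRing k] [Group G] (n : G) (x : MonoidAlgebra k G) :
    MonoidAlgebra.of k G n * x * MonoidAlgebra.of k G n⁻¹ = x ↔
    MonoidAlgebra.of k G n * x = x * MonoidAlgebra.of k G n := by
  have h1 : MonoidAlgebra.of k G n⁻¹ * MonoidAlgebra.of k G n = 1 := by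
    rw [← map_mul]; simp [MonoidAlgebra.one_def]
  have h2 : MonoidAlgebra.of k G n * MonoidAlgebra.of k G n⁻¹ = 1 := by
    rw [← map_mul]; simp [MonoidAlgebra.one_def]
  constructor
  · intro h
    conv_rhs => rw [← h]
    rw [mul_assoc _ _ (MonoidAlgebra.of k G n), h1, mul_one]
  · intro h
    rw [h, mul_assoc, h2, mul_one]

theorem zz_inv_coeff {k G : Type*} [CommRing k] [Group G] (n : G) (x : MonoidAlgebra k G)
    (h : MonoidAlgebra.of k G n * x = x * MonoidAlgebra.of k G n) (g : G) :
    x.coeff (n⁻¹ * g * n) = x.coeff g := by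
  have := congrArg (fun z => MonoidAlgebra.coeff z (g * n)) h
  simpa [MonoidAlgebra.of_apply, MonoidAlgebra.coeff_single_mul_apply,
    MonoidAlgebra.coeff_mul_single_apply, mul_assoc] using this

theorem zz_coeff_inv {k G : Type*} [CommRing k] [Group G] (n : G) (x : MonoidAlgebra k G)
    (h : ∀ g, x.coeff (n⁻¹ * g * n) = x.coeff g) :
    MonoidAlgebra.of k G n * x = x * MonoidAlgebra.of k G n := by
  ext g
  have := h (g * n⁻¹)
  simpa [MonoidAlgebra.of_apply, MonoidAlgebra.coeff_single_mul_apply,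
    MonoidAlgebra.coeff_mul_single_apply, mul_assoc] using this

/-- The homogeneous components of the fixed subring. -/
def zzB (k : Type*) {G : Type*} [CommRing k] [Group G] (N : Subgroup G) (c : G ⧸ N) :
    AddSubgroup (MonoidAlgebra k G) where
  carrier := {x | (∀ g, x.coeff g ≠ 0 → (g : G ⧸ N) = c) ∧
    ∀ n ∈ N, MonoidAlgebra.of k G n * x = x * MonoidAlgebra.of k G n}
  zero_mem' := by simp
  add_mem' := by
    rintro x y ⟨h1, h2⟩ ⟨k1, k2⟩
    refine ⟨fun g hg => ?_, fun n hn => by rw [mul_add, add_mul, h2 n hn, k2 n hn]⟩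
    by_cases h : x.coeff g = 0
    · exact k1 g (by simpa [h] using hg)
    · exact h1 g h
  neg_mem' := by
    rintro x ⟨h1, h2⟩
    exact ⟨fun g hg => h1 g (by simpa using hg), fun n hn => by rw [mul_neg, neg_mul, h2 n hn]⟩

theorem zzB_mul {k G : Type*} [CommRing k] [Group G] [Fintype G] (N : Subgroup G) [N.Normal]
    (c d : G ⧸ N) (x y : MonoidAlgebra k G) (hx : x ∈ zzB k N c) (hy : y ∈ zzB k N d) :
    x * y ∈ zzB k N (c * d) := by
  refine ⟨fun g hg => ?_, fun n hn => by
    rw [← mul_assoc, hx.2 n hn, mul_assoc, hy.2 n hn, mul_assoc]⟩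
  by_contra hne
  apply hg
  rw [MonoidAlgebra.coeff_mul_apply_left]
  refine Finset.sum_eq_zero fun a _ => ?_
  by_cases h1 : x.coeff a = 0
  · simp [h1]
  by_cases h2 : y.coeff (a⁻¹ * g) = 0
  · simp [h2]
  exfalso
  apply hne
  rw [← hx.1 a h1, ← hy.1 _ h2, ← QuotientGroup.mk_mul]
  simp

theorem zzB_one {k G : Type*} [CommRing k] [Group G] (N : Subgroup G) [N.Normal] :
    (1 : MonoidAlgebra k G) ∈ zzB k N 1 := by
  classical
  refine ⟨fun g hg => ?_, by simp⟩
  rw [MonoidAlgebra.one_def, MonoidAlgebra.coeff_single_apply] at hg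
  have : 1 = g := by by_contra h; simp [h] at hg
  subst this; simp

theorem zzB_cent {k G : Type*} [CommRing k] [Group G] [Fintype G] (N : Subgroup G) [N.Normal]
    (c : G ⧸ N) (x y : MonoidAlgebra k G) (hx : x ∈ zzB k N 1) (hy : y ∈ zzB k N c) :
    x * y = y * x := by
  rw [zz_eq_sum x, Finset.sum_mul, Finset.mul_sum]
  refine Finset.sum_congr rfl fun g _ => ?_
  by_cases h : x.coeff g = 0
  · simp [h]
  have hg : g ∈ N := (QuotientGroup.eq_one_iff g).1 (hx.1 g h)
  have := hy.2 g hg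
  have hs : MonoidAlgebra.single g (x.coeff g) = x.coeff g • MonoidAlgebra.of k G g := by
    simp [MonoidAlgebra.of_apply, MonoidAlgebra.smul_single]
  rw [hs, smul_mul_assoc, mul_smul_comm, this]

theorem zzB_pow {k G : Type*} [CommRing k] [Group G] [Fintype G] (N : Subgroup G) [N.Normal]
    (c : G ⧸ N) (x : MonoidAlgebra k G) (hx : x ∈ zzB k N c) (n : ℕ) : x ^ n ∈ zzB k N (c ^ n) := by
  induction n with
  | zero => simpa using zzB_one N
  | succ n ih => rw [pow_succ, pow_succ]; exact zzB_mul N _ _ _ _ ih hx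

theorem zz_frobB {G : Type*} [Group G] [Fintype G] (N : Subgroup G) [N.Normal] (q : ℕ)
    [hq : Fact q.Prime] (hqN : N.index ∣ q - 1) (hqG : ¬ q ∣ Nat.card G)
    (c : G ⧸ N) (x : MonoidAlgebra (ZMod q) G) (hx : x ∈ zzB (ZMod q) N c) :
    x ^ q = MonoidAlgebra.mapDomain (· ^ q) x := by
  refine zz_frob N q hqN hqG c x hx.1
    (fun n hn g => zz_inv_coeff n _ ((zzB_pow N c x hx q).2 n hn) g)
    (fun n hn g => zz_inv_coeff n _ ?_ g)
  rw [← zz_conj_iff, ← zz_psi_conj, (zz_conj_iff n x).2 (hx.2 n hn)]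

theorem zz_psi_comp {k G : Type*} [CommRing k] [Group G] (a b : ℕ) (x : MonoidAlgebra k G) :
    MonoidAlgebra.mapDomain (· ^ a) (MonoidAlgebra.mapDomain (· ^ b) x) =
    MonoidAlgebra.mapDomain (· ^ (b * a)) x := by
  induction x using MonoidAlgebra.induction_linear with
  | zero => simp
  | add x y hx hy => simp only [MonoidAlgebra.mapDomain_add, hx, hy]
  | single g r => simp [MonoidAlgebra.mapDomain_single, pow_mul]

theorem zz_psi_id {k G : Type*} [CommRing k] [Group G] [Fintype G] (a : ℕ)
    (ha : a ≡ 1 [MOD Nat.card G]) (x : MonoidAlgebra k G) :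
    MonoidAlgebra.mapDomain (· ^ a) x = x := by
  induction x using MonoidAlgebra.induction_linear with
  | zero => simp
  | add x y hx hy => simp only [MonoidAlgebra.mapDomain_add, hx, hy]
  | single g r =>
    have : g ^ a = g := by
      conv_rhs => rw [← pow_one g]
      exact pow_eq_pow_iff_modEq.2 (ha.of_dvd (orderOf_dvd_natCard g))
    simp [MonoidAlgebra.mapDomain_single, this]

theorem zz_homog {G : Type*} [Group G] [Fintype G] (N : Subgroup G) [N.Normal] (q : ℕ)
    [hq : Fact q.Prime] (hqN : N.index ∣ q - 1) (hqG : ¬ q ∣ Nat.card G)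
    (c d : G ⧸ N) (x y : MonoidAlgebra (ZMod q) G) (hx : x ∈ zzB (ZMod q) N c)
    (hy : y ∈ zzB (ZMod q) N d) :
    MonoidAlgebra.mapDomain (· ^ q) (x * y) =
      MonoidAlgebra.mapDomain (· ^ q) x * MonoidAlgebra.mapDomain (· ^ q) y := by
  have hiter : ∀ (r : ℕ) (c : G ⧸ N) x, x ∈ zzB (ZMod q) N c →
      x ^ (q ^ r) = MonoidAlgebra.mapDomain (· ^ (q ^ r)) x := by
    intro r
    induction r with
    | zero =>
      intro c x hx
      rw [pow_zero, zz_psi_id 1 rfl, pow_one]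
    | succ r ih =>
      intro c x hx
      rw [pow_succ, pow_mul, zz_frobB N q hqN hqG _ _ (zzB_pow N c x hx _), ih c x hx, zz_psi_comp]
  have hq2 := hq.out.two_le
  have hcop : Nat.Coprime q (Nat.card G) := (Nat.Prime.coprime_iff_not_dvd hq.out).2 hqG
  have hr0 : (Nat.card G).totient ≠ 0 := (Nat.totient_pos.2 Nat.card_pos).ne'
  set r := (Nat.card G).totient with hr
  have hmod : q ^ r ≡ 1 [MOD Nat.card G] := Nat.ModEq.pow_totient hcop
  have hfix : ∀ (c : G ⧸ N) x, x ∈ zzB (ZMod q) N c → x ^ (q ^ r - 1 + 1) = x := by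
    intro c x hx
    rw [Nat.sub_add_cancel (Nat.one_le_pow _ _ (by omega)), hiter r c x hx, zz_psi_id _ hmod]
  have hqr : 2 ≤ q ^ r := hq2.trans (Nat.le_self_pow hr0 q)
  rw [← zz_frobB N q hqN hqG _ _ (zzB_mul N _ _ _ _ hx hy), ← zz_frobB N q hqN hqG _ _ hx,
    ← zz_frobB N q hqN hqG _ _ hy]
  rw [Subgroup.index_eq_card] at hqN
  refine zz_graded (zzB (ZMod q) N) (zzB_one N) (zzB_mul N) (zzB_cent N) q (by omega) hqN
    (q ^ r - 1) (by omega) (hqN.trans ?_) c d x y hx hy (hfix c x hx) (hfix d y hy)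
  simpa using Nat.sub_dvd_pow_sub_pow q 1 r

theorem zz_decomp {k G : Type*} [CommRing k] [Group G] [Fintype G] (N : Subgroup G) [N.Normal]
    [Fintype (G ⧸ N)] (x : MonoidAlgebra k G)
    (hx : ∀ n ∈ N, MonoidAlgebra.of k G n * x = x * MonoidAlgebra.of k G n) :
    ∃ f : G ⧸ N → MonoidAlgebra k G, (∀ c, f c ∈ zzB k N c) ∧ x = ∑ c, f c := by
  classical
  refine ⟨fun c => .ofCoeff (x.coeff.filter fun g => (g : G ⧸ N) = c), fun c => ⟨?_, ?_⟩, ?_⟩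
  · intro g hg
    by_contra h
    exact hg (Finsupp.filter_apply_neg _ _ h)
  · intro n hn
    apply zz_coeff_inv
    intro g
    have hm : ((n⁻¹ * g * n : G) : G ⧸ N) = g := by
      have h1 : (n : G ⧸ N) = 1 := (QuotientGroup.eq_one_iff n).2 hn
      simp [h1]
    simp only [Finsupp.filter_apply, hm]
    rw [zz_inv_coeff n x (hx n hn)]
  · ext g
    simp [MonoidAlgebra.coeff_sum, Finsupp.filter_apply]

theorem zz_modq {G : Type*} [Group G] [Fintype G] (N : Subgroup G) [N.Normal] (q : ℕ)
    [hq : Fact q.Prime] (hqN : N.index ∣ q - 1) (hqG : ¬ q ∣ Nat.card G)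
    (x y : MonoidAlgebra (ZMod q) G)
    (hx : ∀ n ∈ N, MonoidAlgebra.of (ZMod q) G n * x = x * MonoidAlgebra.of (ZMod q) G n)
    (hy : ∀ n ∈ N, MonoidAlgebra.of (ZMod q) G n * y = y * MonoidAlgebra.of (ZMod q) G n) :
    MonoidAlgebra.mapDomain (· ^ q) (x * y) =
      MonoidAlgebra.mapDomain (· ^ q) x * MonoidAlgebra.mapDomain (· ^ q) y := by
  classical
  have : Fintype (G ⧸ N) := Fintype.ofFinite _
  obtain ⟨f, hf, rfl⟩ := zz_decomp N x hx
  obtain ⟨f', hf', rfl⟩ := zz_decomp N y hy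
  rw [Finset.sum_mul_sum, zz_psi_sum, zz_psi_sum, zz_psi_sum, Finset.sum_mul_sum]
  refine Finset.sum_congr rfl fun c _ => ?_
  rw [zz_psi_sum]
  exact Finset.sum_congr rfl fun d _ => zz_homog N q hqN hqG c d _ _ (hf c) (hf' d)

theorem zz_map_psi {k l G : Type*} [CommRing k] [CommRing l] [Group G] (φ : k →+* l) (n : ℕ)
    (x : MonoidAlgebra k G) :
    MonoidAlgebra.mapRingHom G φ (MonoidAlgebra.mapDomain (· ^ n) x) =
      MonoidAlgebra.mapDomain (· ^ n) (MonoidAlgebra.mapRingHom G φ x) := by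
  induction x using MonoidAlgebra.induction_linear with
  | zero => simp
  | add x y hx hy => simp only [MonoidAlgebra.mapDomain_add, map_add, hx, hy]
  | single g r => simp only [MonoidAlgebra.mapDomain_single, MonoidAlgebra.mapRingHom_single]

theorem zz_psi_congr {k G : Type*} [CommRing k] [Group G] [Fintype G] (a b : ℕ)
    (ha : a ≡ b [MOD Nat.card G]) (x : MonoidAlgebra k G) :
    MonoidAlgebra.mapDomain (· ^ a) x = MonoidAlgebra.mapDomain (· ^ b) x := by
  congr 1
  funext g
  exact pow_eq_pow_iff_modEq.2 (ha.of_dvd (orderOf_dvd_natCard g))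

theorem zz_int {G : Type*} [Group G] [Fintype G] (N : Subgroup G) [N.Normal] (n : ℕ)
    (hn : n.Coprime (Nat.card G)) (hnN : n ≡ 1 [MOD N.index])
    (x y : MonoidAlgebra ℤ G)
    (hx : ∀ n ∈ N, MonoidAlgebra.of ℤ G n * x = x * MonoidAlgebra.of ℤ G n)
    (hy : ∀ n ∈ N, MonoidAlgebra.of ℤ G n * y = y * MonoidAlgebra.of ℤ G n) :
    MonoidAlgebra.mapDomain (· ^ n) (x * y) =
      MonoidAlgebra.mapDomain (· ^ n) x * MonoidAlgebra.mapDomain (· ^ n) y := by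
  rw [← sub_eq_zero]
  set D := MonoidAlgebra.mapDomain (· ^ n) (x * y) -
      MonoidAlgebra.mapDomain (· ^ n) x * MonoidAlgebra.mapDomain (· ^ n) y with hD
  ext g
  obtain ⟨q, hqgt, hqp, hqn⟩ := Nat.forall_exists_prime_gt_and_modEq
    (max (Nat.card G) (D.coeff g).natAbs) (Nat.card_pos (α := G)).ne' hn
  have : Fact q.Prime := ⟨hqp⟩
  have hqG : ¬ q ∣ Nat.card G := fun h => by
    have := Nat.le_of_dvd Nat.card_pos h
    have := le_max_left (Nat.card G) (D.coeff g).natAbs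
    omega
  have hqN : N.index ∣ q - 1 := by
    have h1 : q ≡ 1 [MOD N.index] := (hqn.of_dvd N.index_dvd_card).trans hnN
    exact (Nat.modEq_iff_dvd' hqp.one_le).1 h1.symm
  let φ := MonoidAlgebra.mapRingHom G (Int.castRingHom (ZMod q))
  have hφ : ∀ x : MonoidAlgebra ℤ G,
      (∀ n ∈ N, MonoidAlgebra.of ℤ G n * x = x * MonoidAlgebra.of ℤ G n) →
      ∀ n ∈ N, MonoidAlgebra.of (ZMod q) G n * φ x = φ x * MonoidAlgebra.of (ZMod q) G n := by
    intro x hx n hn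
    have := congrArg φ (hx n hn)
    simpa [φ, MonoidAlgebra.of_apply, MonoidAlgebra.mapRingHom_single] using this
  have h0 : φ D = 0 := by
    rw [hD, map_sub, map_mul, zz_map_psi, zz_map_psi, zz_map_psi, map_mul, sub_eq_zero]
    rw [← zz_psi_congr q n hqn, ← zz_psi_congr q n hqn, ← zz_psi_congr q n hqn]
    exact zz_modq N q hqN hqG _ _ (hφ x hx) (hφ y hy)
  have h1 := congrArg (fun z => MonoidAlgebra.coeff z g) h0
  simp only [φ, MonoidAlgebra.coeff_mapRingHom] at h1
  have h2 : (q : ℤ) ∣ D.coeff g := (ZMod.intCast_zmod_eq_zero_iff_dvd _ _).1 (by simpa using h1)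
  have h3 := Int.eq_zero_of_abs_lt_dvd h2 (by
    have := le_max_right (Nat.card G) (D.coeff g).natAbs
    rw [Int.abs_eq_natAbs]
    omega)
  simpa using h3


/-- Let `p` be a prime, `G` a finite group, `N ⊴ G` with `[G:N]` a power
of `p`. The `ℤ`-linear map `ζ_G : ℤ[G] → ℤ[G]` given on group elements by
`ζ_G g = g_p * g_{p'} ^ p` (where `g = g_p * g_{p'}` is the unique decomposition into
commuting `p`-part and `p'`-part, both powers of `g`) maps the fixed-point subring
`(ℤ[G])^N` bijectively onto itself, and its restriction to `(ℤ[G])^N` is a ring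
automorphism. -/
theorem stmt0 {p : ℕ} (hp : p.Prime) {G : Type*} [Group G] [Fintype G]
    (N : Subgroup G) [N.Normal] (hN : ∃ k : ℕ, N.index = p ^ k)
    (gp gp' : G → G)
    (hmul : ∀ g : G, gp g * gp' g = g)
    (hcomm : ∀ g : G, Commute (gp g) (gp' g))
    (hordp : ∀ g : G, ∃ k : ℕ, orderOf (gp g) = p ^ k)
    (hordp' : ∀ g : G, Nat.Coprime (orderOf (gp' g)) p)
    (hpowp : ∀ g : G, ∃ k : ℕ, gp g = g ^ k)
    (hpowp' : ∀ g : G, ∃ k : ℕ, gp' g = g ^ k)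
    (ζ : MonoidAlgebra ℤ G →ₗ[ℤ] MonoidAlgebra ℤ G)
    (hζ : ∀ g : G, ζ (MonoidAlgebra.of ℤ G g) = MonoidAlgebra.of ℤ G (gp g * (gp' g) ^ p)) :
    let S : Set (MonoidAlgebra ℤ G) :=
      {a | ∀ n ∈ N, MonoidAlgebra.of ℤ G n * a * MonoidAlgebra.of ℤ G n⁻¹ = a}
    Set.BijOn ζ S S ∧ (∀ a ∈ S, ∀ b ∈ S, ζ (a * b) = ζ a * ζ b) ∧ ζ 1 = 1 := by

  intro S
  -- choice of the exponent
  obtain ⟨a, m, hpm, hG⟩ := Nat.exists_eq_pow_mul_and_not_dvd (Nat.card_pos (α := G)).ne' p hp.ne_one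
  have hcop : Nat.Coprime (p ^ a) m := Nat.Coprime.pow_left _ ((Nat.Prime.coprime_iff_not_dvd hp).2 hpm)
  obtain ⟨n, hn1, hnp⟩ := Nat.chineseRemainder hcop 1 p
  have hpcm : Nat.Coprime p m := (Nat.Prime.coprime_iff_not_dvd hp).2 hpm
  have hnc : n.Coprime (Nat.card G) := by
    rw [hG]
    refine Nat.Coprime.mul_right ?_ ?_
    · exact (hn1.gcd_eq).trans (by simp)
    · exact (hnp.gcd_eq).trans hpcm
  obtain ⟨k, hk⟩ := hN
  have hka : p ^ k ∣ p ^ a := by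
    have h1 : p ^ k ∣ p ^ a * m := by rw [← hk, ← hG]; exact N.index_dvd_card
    exact (Nat.Coprime.pow_left k hpcm).dvd_of_dvd_mul_right h1
  have hnN : n ≡ 1 [MOD N.index] := by rw [hk]; exact hn1.of_dvd hka
  have hgn : ∀ g : G, gp g * gp' g ^ p = g ^ n := by
    intro g
    conv_rhs => rw [← hmul g, (hcomm g).mul_pow]
    congr 1
    · obtain ⟨j, hj⟩ := hordp g
      have h1 : orderOf (gp g) ∣ p ^ a := by
        have h2 := orderOf_dvd_natCard (gp g)
        rw [hj] at h2 ⊢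
        rw [hG] at h2
        exact (Nat.Coprime.pow_left j hpcm).dvd_of_dvd_mul_right h2
      conv_lhs => rw [← pow_one (gp g)]
      exact pow_eq_pow_iff_modEq.2 (hn1.of_dvd h1).symm
    · have h1 : orderOf (gp' g) ∣ m := by
        have h2 := orderOf_dvd_natCard (gp' g)
        rw [hG] at h2
        exact (Nat.Coprime.pow_right a (hordp' g)).dvd_of_dvd_mul_left h2
      exact pow_eq_pow_iff_modEq.2 (hnp.of_dvd h1).symm
  have hζn : ∀ x, ζ x = MonoidAlgebra.mapDomain (· ^ n) x := by
    intro x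
    induction x using MonoidAlgebra.induction_linear with
    | zero => simp
    | add x y hx hy => rw [map_add, hx, hy, MonoidAlgebra.mapDomain_add]
    | single g r =>
      have hs : ∀ g : G, MonoidAlgebra.single g r = r • MonoidAlgebra.of ℤ G g := by
        intro g; simp [MonoidAlgebra.of_apply, MonoidAlgebra.smul_single]
      rw [MonoidAlgebra.mapDomain_single, hs, hs, map_smul, hζ, hgn]
  have hpres : ∀ (j : ℕ), ∀ x ∈ S, MonoidAlgebra.mapDomain (· ^ j) x ∈ S := by
    intro j x hx u hu
    rw [← zz_psi_conj, hx u hu]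
  obtain ⟨n', hn'⟩ : ∃ n', n * n' ≡ 1 [MOD Nat.card G] := by
    refine ⟨n ^ ((Nat.card G).totient - 1), ?_⟩
    rw [← pow_succ', Nat.sub_add_cancel (Nat.totient_pos.2 Nat.card_pos)]
    exact Nat.ModEq.pow_totient hnc
  refine ⟨⟨fun x hx => ?_, ?_, ?_⟩, ?_, ?_⟩
  · rw [hζn]; exact hpres n x hx
  · intro x _ y _ hxy
    rw [hζn, hζn] at hxy
    have := congrArg (MonoidAlgebra.mapDomain (· ^ n')) hxy
    rwa [zz_psi_comp, zz_psi_comp, zz_psi_id _ hn', zz_psi_id _ hn'] at this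
  · intro x hx
    refine ⟨MonoidAlgebra.mapDomain (· ^ n') x, hpres n' x hx, ?_⟩
    rw [hζn, zz_psi_comp, mul_comm, zz_psi_id _ hn']
  · intro x hx y hy
    rw [hζn, hζn, hζn]
    exact zz_int N n hnc hnN x y (fun u hu => (zz_conj_iff u x).1 (hx u hu))
      (fun u hu => (zz_conj_iff u y).1 (hy u hu))
  · rw [hζn, MonoidAlgebra.one_def, MonoidAlgebra.mapDomain_single, one_pow]
end

section
/- Let n ≥ 1 and let P = Q8 × C_{2^n}. Then every subgroup of P is isomorphic to one of the following groups for some natural number m: the trivial group, C_{2^m}, C2 × C_{2^m}, C4 × C_{2^m}, Q8, Q8 × C_{2^m}, or C4 ⋊ C_{2^m} with m ≥ 2 in the last case. -/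
/-- The hom from the cyclic group of order `N` sending the generator to `u`. -/
noncomputable def zh {G : Type*} [Group G] (N : ℕ) (u : G) (h : u ^ N = 1) :
    Multiplicative (ZMod N) →* G :=
  AddMonoidHom.toMultiplicativeLeft (ZMod.lift N ⟨zmultiplesHom (Additive G) (Additive.ofMul u), by
    simp [← ofMul_pow, h]⟩)

lemma zh_cast {G : Type*} [Group G] (N : ℕ) (u : G) (h : u ^ N = 1) (z : ℤ) :
    zh N u h (Multiplicative.ofAdd (z : ZMod N)) = u ^ z := by
  simp [zh]

lemma exists_int (N : ℕ) (a : Multiplicative (ZMod N)) :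
    ∃ z : ℤ, a = Multiplicative.ofAdd (z : ZMod N) := by
  obtain ⟨z, hz⟩ := ZMod.intCast_surjective (Multiplicative.toAdd a)
  exact ⟨z, by rw [hz]; rfl⟩

lemma zh_inj {G : Type*} [Group G] (N : ℕ) (u : G) (h : u ^ N = 1) (hu : orderOf u = N) :
    Function.Injective (zh N u h) := by
  rw [injective_iff_map_eq_one]
  intro a ha
  obtain ⟨z, rfl⟩ := exists_int N a
  rw [zh_cast, ← orderOf_dvd_iff_zpow_eq_one, hu] at ha
  rw [(ZMod.intCast_zmod_eq_zero_iff_dvd z N).2 ha]; rfl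

lemma zh_range {G : Type*} [Group G] (N : ℕ) (u : G) (h : u ^ N = 1) :
    (zh N u h).range = Subgroup.zpowers u := by
  ext w
  simp only [MonoidHom.mem_range, Subgroup.mem_zpowers_iff]
  constructor
  · rintro ⟨a, rfl⟩
    obtain ⟨z, rfl⟩ := exists_int N a
    exact ⟨z, (zh_cast N u h z).symm⟩
  · rintro ⟨z, rfl⟩
    exact ⟨_, zh_cast N u h z⟩

/-- Main splitting lemma. -/
lemma split {A C K' : Type*} [Group A] [CommGroup C] [Group K'] (Q : Subgroup (A × C))
    (f : K' →* A) (hf : Function.Injective f) (hr : ∀ k : A, (k, 1) ∈ Q ↔ k ∈ f.range)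
    (x : A) (c : C) (N : ℕ) (hg : (x, c) ∈ Q) (hgen : ∀ q ∈ Q, ∃ z : ℤ, q.2 = c ^ z)
    (hc : orderOf c = N) (hx : x ^ N = 1)
    (φ : Multiplicative (ZMod N) →* MulAut K')
    (hφ : ∀ k, f (φ (Multiplicative.ofAdd 1) k) = x * f k * x⁻¹) :
    Nonempty (Q ≃* K' ⋊[φ] Multiplicative (ZMod N)) := by
  have hcN : c ^ N = 1 := by rw [← hc]; exact pow_orderOf_eq_one c
  have hgN : ((x, c) : A × C) ^ N = 1 := by
    rw [Prod.pow_mk, hx, hcN]; rfl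
  have hφ' : ∀ (z : ℤ) k, f (φ (Multiplicative.ofAdd (z : ZMod N)) k) = x ^ z * f k * (x ^ z)⁻¹ := by
    intro z
    have e : (Multiplicative.ofAdd (z : ZMod N)) = (Multiplicative.ofAdd (1 : ZMod N)) ^ z := by
      rw [← ofAdd_zsmul]; simp
    rw [e, map_zpow]
    induction z using Int.induction_on with
    | zero => simp
    | succ i ih =>
      intro k
      rw [zpow_add_one, MulAut.mul_apply, ih (by rw [← ofAdd_zsmul]; simp), hφ, zpow_add_one]
      group
    | pred i ih =>
      intro k
      rw [zpow_sub_one, MulAut.mul_apply, ih (by rw [← ofAdd_zsmul]; simp), zpow_sub_one]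
      have := hφ ((φ (Multiplicative.ofAdd 1))⁻¹ k)
      rw [MulAut.apply_inv_self] at this
      rw [this]
      group
  let F : K' ⋊[φ] Multiplicative (ZMod N) →* A × C :=
    SemidirectProduct.lift ((MonoidHom.inl A C).comp f) (zh N (x, c) hgN) (by
      intro a
      obtain ⟨z, rfl⟩ := exists_int N a
      ext k
      · simp [zh_cast, hφ']
      · simp [zh_cast])
  have hF : ∀ k (z : ℤ), F ⟨k, Multiplicative.ofAdd (z : ZMod N)⟩ = (f k * x ^ z, c ^ z) := by
    intro k z
    simp [F, SemidirectProduct.lift, zh_cast]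
  have hinj : Function.Injective F := by
    rw [injective_iff_map_eq_one]
    rintro ⟨k, a⟩ h
    obtain ⟨z, rfl⟩ := exists_int N a
    rw [hF, Prod.mk_eq_one] at h
    obtain ⟨h1, h2⟩ := h
    rw [← orderOf_dvd_iff_zpow_eq_one, hc] at h2
    have hxz : x ^ z = 1 := by
      obtain ⟨w, rfl⟩ := h2
      rw [zpow_mul, zpow_natCast, hx, one_zpow]
    rw [hxz, mul_one] at h1
    have hk : k = 1 := hf (by rw [h1, map_one])
    rw [(ZMod.intCast_zmod_eq_zero_iff_dvd z N).2 h2, hk]; rfl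
  have hrange : F.range = Q := by
    ext q
    constructor
    · rintro ⟨⟨k, a⟩, rfl⟩
      obtain ⟨z, rfl⟩ := exists_int N a
      rw [hF]
      have := Q.mul_mem ((hr (f k)).2 ⟨k, rfl⟩) (Q.zpow_mem hg z)
      simpa using this
    · intro hq
      obtain ⟨z, hz⟩ := hgen q hq
      have h1 : (q.1 * x ^ (-z), 1) ∈ Q := by
        have := Q.mul_mem hq (Q.zpow_mem hg (-z))
        have e : q * (x, c) ^ (-z) = (q.1 * x ^ (-z), 1) := by
          ext
          · simp
          · simp [hz]
        rwa [e] at this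
      obtain ⟨k, hk⟩ := (hr _).1 h1
      refine ⟨⟨k, Multiplicative.ofAdd (z : ZMod N)⟩, ?_⟩
      rw [hF, hk]
      ext
      · simp
      · simp [hz]
  exact ⟨((MonoidHom.ofInjective hinj).trans (MulEquiv.subgroupCongr hrange)).symm⟩

lemma split_prod {A C K' : Type*} [Group A] [CommGroup C] [Group K'] (Q : Subgroup (A × C))
    (f : K' →* A) (hf : Function.Injective f) (hr : ∀ k : A, (k, 1) ∈ Q ↔ k ∈ f.range)
    (x : A) (c : C) (N : ℕ) (hg : (x, c) ∈ Q) (hgen : ∀ q ∈ Q, ∃ z : ℤ, q.2 = c ^ z)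
    (hc : orderOf c = N) (hx : x ^ N = 1)
    (hφ : ∀ k, f k = x * f k * x⁻¹) :
    Nonempty (Q ≃* K' × Multiplicative (ZMod N)) := by
  obtain ⟨e⟩ := split Q f hf hr x c N hg hgen hc hx 1 (by simpa using hφ)
  exact ⟨e.trans SemidirectProduct.mulEquivProd⟩

set_option maxRecDepth 100000 in
lemma q8_gen : ∀ u v w : QuaternionGroup 2, u^2 = .a 2 → (v ≠ 1 ∧ v ≠ u ∧ v ≠ u^2 ∧ v ≠ u^3) →
    ∃ i j : Fin 4, w = u^(i:ℕ) * v^(j:ℕ) := by decide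

lemma q8_cases : ∀ x : QuaternionGroup 2, x = 1 ∨ x = .a 2 ∨ x^2 = .a 2 := by decide

lemma q8_sq : (QuaternionGroup.a 2 : QuaternionGroup 2) ^ 2 = 1 := by decide

lemma q8_ne : (QuaternionGroup.a 2 : QuaternionGroup 2) ≠ 1 := by decide

lemma q8_central : ∀ x : QuaternionGroup 2, x * .a 2 * x⁻¹ = .a 2 := by decide

set_option maxRecDepth 100000 in
lemma q8_conj : ∀ u v : QuaternionGroup 2, u^2 = .a 2 → (v ≠ 1 ∧ v ≠ u ∧ v ≠ u^2 ∧ v ≠ u^3) →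
    v * u * v⁻¹ = u⁻¹ ∧ v^2 = .a 2 := by decide

lemma q8_pow (x : QuaternionGroup 2) (h : x ^ 2 = .a 2) (r : ℕ) (hr : 2 ≤ r) : x ^ 2 ^ r = 1 := by
  obtain ⟨s, rfl⟩ := Nat.exists_eq_add_of_le hr
  rw [pow_add, pow_mul, show (2 ^ 2 : ℕ) = 2 * 2 by norm_num, pow_mul, h, q8_sq, one_pow]

lemma q8_order (x : QuaternionGroup 2) (h : x ^ 2 = .a 2) : orderOf x = 4 := by
  have := orderOf_eq_prime_pow (p := 2) (n := 1) (x := x)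
    (by rw [pow_one, h]; exact q8_ne) (q8_pow x h 2 le_rfl)
  simpa using this

/-- If the image in `C` has order two and `x ∉ K`, then the first projection is injective. -/
lemma fst_inj {A C : Type*} [Group A] [CommGroup C] (Q : Subgroup (A × C))
    (x : A) (c : C) (hg : (x, c) ∈ Q) (hgen : ∀ q ∈ Q, ∃ z : ℤ, q.2 = c ^ z)
    (hc : c ^ 2 = 1) (hx : (x, 1) ∉ Q) :
    Function.Injective ((MonoidHom.fst A C).comp Q.subtype) := by
  rw [injective_iff_map_eq_one]
  rintro ⟨⟨a, d⟩, hq⟩ h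
  have ha : a = 1 := h
  subst ha
  obtain ⟨z, hz⟩ := hgen _ hq
  simp only at hz
  have hz2 : ∀ w : ℤ, c ^ (2 * w) = 1 := fun w => by
    rw [zpow_mul, zpow_ofNat, hc, one_zpow]
  rcases Int.even_or_odd' z with ⟨w, rfl | rfl⟩
  · rw [hz2] at hz
    subst hz; rfl
  · exfalso
    rw [zpow_add, hz2, one_mul, zpow_one] at hz
    subst hz
    apply hx
    have := Q.mul_mem hg (Q.inv_mem hq)
    simpa using this

theorem stmt3 (n : ℕ) (hn : 1 ≤ n)
    (Q : Subgroup (QuaternionGroup 2 × Multiplicative (ZMod (2 ^ n)))) :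
    ∃ m : ℕ,
      Nonempty (Q ≃* Multiplicative (ZMod 1)) ∨
      Nonempty (Q ≃* Multiplicative (ZMod (2 ^ m))) ∨
      Nonempty (Q ≃* Multiplicative (ZMod 2) × Multiplicative (ZMod (2 ^ m))) ∨
      Nonempty (Q ≃* Multiplicative (ZMod 4) × Multiplicative (ZMod (2 ^ m))) ∨
      Nonempty (Q ≃* QuaternionGroup 2) ∨
      Nonempty (Q ≃* QuaternionGroup 2 × Multiplicative (ZMod (2 ^ m))) ∨
      (2 ≤ m ∧
        ∃ φ : Multiplicative (ZMod (2 ^ m)) →* MulAut (Multiplicative (ZMod 4)),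
          φ (Multiplicative.ofAdd (1 : ZMod (2 ^ m))) = MulEquiv.inv (Multiplicative (ZMod 4)) ∧
          Nonempty (Q ≃* (Multiplicative (ZMod 4)) ⋊[φ] (Multiplicative (ZMod (2 ^ m))))) := by
  -- generator of the image in the cyclic factor
  obtain ⟨⟨c, hcm⟩, hcg⟩ := IsCyclic.exists_generator
    (α := Q.map (MonoidHom.snd (QuaternionGroup 2) (Multiplicative (ZMod (2 ^ n)))))
  obtain ⟨⟨x, c'⟩, hg, hcc⟩ := hcm
  have hcc' : c' = c := hcc
  subst hcc'
  rename' c' => c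
  have hgen : ∀ q ∈ Q, ∃ z : ℤ, q.2 = c ^ z := by
    intro q hq
    obtain ⟨z, hz⟩ := hcg ⟨q.2, ⟨q, hq, rfl⟩⟩
    exact ⟨z, (congrArg Subtype.val hz).symm⟩
  have hcard : Nat.card (Multiplicative (ZMod (2 ^ n))) = 2 ^ n := by
    rw [Nat.card_congr Multiplicative.toAdd, Nat.card_zmod]
  obtain ⟨r, -, hc⟩ : ∃ r ≤ n, orderOf c = 2 ^ r := by
    rw [← Nat.dvd_prime_pow Nat.prime_two]
    exact (orderOf_dvd_natCard c).trans hcard.dvd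
  have hcr : c ^ 2 ^ r = 1 := by rw [← hc]; exact pow_orderOf_eq_one c
  -- the kernel
  let K : Subgroup (QuaternionGroup 2) := Q.comap (MonoidHom.inl _ _)
  have hK : ∀ k, k ∈ K ↔ (k, 1) ∈ Q := fun k => Iff.rfl
  have hxK : x ^ 2 ^ r ∈ K := by
    rw [hK]
    have := Q.pow_mem hg (2 ^ r)
    rwa [Prod.pow_mk, hcr] at this
  have hone : x ∈ K → ((1 : QuaternionGroup 2), c) ∈ Q := by
    intro h
    have := Q.mul_mem (Q.inv_mem ((hK x).1 h)) hg
    simpa using this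
  by_cases hm : QuaternionGroup.a 2 ∈ K
  swap
  · -- trivial kernel
    have hK1 : ∀ k ∈ K, k = 1 := by
      intro k hk
      rcases q8_cases k with h | h | h
      · exact h
      · exact absurd (h ▸ hk) hm
      · exact absurd (h ▸ K.pow_mem hk 2) hm
    refine ⟨r, Or.inr (Or.inl ?_)⟩
    have hx1 := hK1 _ hxK
    obtain ⟨e⟩ := split_prod (K' := Unit) Q 1 (fun _ _ _ => rfl) (by
      intro k
      rw [← hK]
      constructor
      · intro hk; rw [hK1 k hk]; exact one_mem _
      · rintro ⟨_, rfl⟩; exact one_mem _) x c (2 ^ r) hg hgen hc hx1 (by simp)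
    exact ⟨e.trans MulEquiv.uniqueProd⟩
  by_cases h4 : ∃ u ∈ K, u ^ 2 = QuaternionGroup.a 2
  swap
  · -- kernel of order two
    have hK2 : ∀ k ∈ K, k = 1 ∨ k = .a 2 := by
      intro k hk
      rcases q8_cases k with h | h | h
      · exact Or.inl h
      · exact Or.inr h
      · exact absurd ⟨k, hk, h⟩ h4
    have hord : orderOf (QuaternionGroup.a 2 : QuaternionGroup 2) = 2 :=
      orderOf_eq_prime q8_sq q8_ne
    have hr2 : ∀ k, (k, 1) ∈ Q ↔ k ∈ (zh 2 (QuaternionGroup.a 2 : QuaternionGroup 2) q8_sq).range := by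
      intro k
      rw [zh_range, ← hK]
      constructor
      · intro hk
        rcases hK2 k hk with rfl | rfl
        · exact one_mem _
        · exact Subgroup.mem_zpowers _
      · intro hk
        exact (Subgroup.zpowers_le.2 hm) hk
    have hinj := zh_inj 2 _ q8_sq hord
    by_cases hx : x ∈ K
    · exact ⟨r, Or.inr (Or.inr (Or.inl
        (split_prod Q _ hinj hr2 1 c (2 ^ r) (hone hx) hgen hc (one_pow _) (by simp))))⟩
    have hx2 : x ^ 2 = .a 2 := by
      rcases q8_cases x with h | h | h
      · exact absurd (h ▸ one_mem K) hx
      · exact absurd (h ▸ hm) hx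
      · exact h
    rcases Nat.lt_or_ge r 2 with hr | hr
    · interval_cases r
      · simp at hxK; exact absurd hxK hx
      · have hi := fst_inj Q x c hg hgen (by simpa using hcr) hx
        have hrg : ((MonoidHom.fst _ _).comp Q.subtype).range = (zh 4 x (q8_pow x hx2 2 le_rfl)).range := by
          rw [zh_range]
          ext w
          constructor
          · rintro ⟨⟨q, hq⟩, rfl⟩
            obtain ⟨z, hz⟩ := hgen q hq
            have h1 : (q.1 * x ^ (-z), 1) ∈ Q := by
              have := Q.mul_mem hq (Q.zpow_mem hg (-z))
              have e : q * (x, c) ^ (-z) = (q.1 * x ^ (-z), 1) := by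
                ext
                · simp
                · simp [hz]
              rwa [e] at this
            have h2 : q.1 * x ^ (-z) ∈ Subgroup.zpowers x := by
              rcases hK2 _ h1 with h | h
              · rw [h]; exact one_mem _
              · rw [h, ← hx2]; exact pow_mem (Subgroup.mem_zpowers _) _
            have := mul_mem h2 (zpow_mem (Subgroup.mem_zpowers x) z)
            simpa using this
          · rintro ⟨z, rfl⟩
            exact ⟨⟨(x, c) ^ z, Q.zpow_mem hg z⟩, by simp⟩
        have hinj4 := zh_inj 4 x (q8_pow x hx2 2 le_rfl) (q8_order x hx2)
        exact ⟨2, Or.inr (Or.inl ⟨((MonoidHom.ofInjective hi).trans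
          (MulEquiv.subgroupCongr hrg)).trans (MonoidHom.ofInjective hinj4).symm⟩)⟩
    · exact ⟨r, Or.inr (Or.inr (Or.inl
        (split_prod Q _ hinj hr2 x c (2 ^ r) hg hgen hc (q8_pow x hx2 r hr) (by
          intro k
          obtain ⟨z, rfl⟩ := exists_int 2 k
          rw [zh_cast, ← conj_zpow, q8_central]))))⟩
  obtain ⟨u, huK, hu⟩ := h4
  by_cases htop : K = ⊤
  · have hmem : ∀ k, k ∈ K := fun k => htop ▸ Subgroup.mem_top k
    refine ⟨r, Or.inr (Or.inr (Or.inr (Or.inr (Or.inr (Or.inl ?_)))))⟩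
    exact split_prod Q (MonoidHom.id _) Function.injective_id
      (fun k => ⟨fun _ => ⟨k, rfl⟩, fun _ => hmem k⟩) 1 c (2 ^ r) (hone (hmem x)) hgen hc
      (one_pow _) (by simp)
  have hnot : ∀ v, v ∉ K → (v ≠ 1 ∧ v ≠ u ∧ v ≠ u^2 ∧ v ≠ u^3) := by
    intro v hv
    refine ⟨?_, ?_, ?_, ?_⟩ <;> rintro rfl
    · exact hv (one_mem K)
    · exact hv huK
    · exact hv (K.pow_mem huK 2)
    · exact hv (K.pow_mem huK 3)
  have hKu : ∀ k ∈ K, k ∈ Subgroup.zpowers u := by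
    intro k hk
    by_contra hku
    apply htop
    rw [Subgroup.eq_top_iff']
    intro w
    obtain ⟨i, j, rfl⟩ := q8_gen u k w hu (by
      refine ⟨?_, ?_, ?_, ?_⟩ <;> rintro rfl
      · exact hku (one_mem _)
      · exact hku (Subgroup.mem_zpowers _)
      · exact hku (pow_mem (Subgroup.mem_zpowers _) 2)
      · exact hku (pow_mem (Subgroup.mem_zpowers _) 3))
    exact K.mul_mem (K.pow_mem huK _) (K.pow_mem hk _)
  have hu4 : u ^ 4 = 1 := q8_pow u hu 2 le_rfl
  have hinj := zh_inj 4 u hu4 (q8_order u hu)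
  have hr4 : ∀ k, (k, 1) ∈ Q ↔ k ∈ (zh 4 u hu4).range := by
    intro k
    rw [zh_range, ← hK]
    exact ⟨hKu k, fun hk => (Subgroup.zpowers_le.2 huK) hk⟩
  by_cases hx : x ∈ K
  · exact ⟨r, Or.inr (Or.inr (Or.inr (Or.inl
      (split_prod Q _ hinj hr4 1 c (2 ^ r) (hone hx) hgen hc (one_pow _) (by simp)))))⟩
  obtain ⟨hxu, hx2⟩ := q8_conj u x hu (hnot x hx)
  rcases Nat.lt_or_ge r 2 with hr | hr
  · interval_cases r
    · simp at hxK; exact absurd hxK hx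
    · have hi := fst_inj Q x c hg hgen (by simpa using hcr) hx
      refine ⟨0, Or.inr (Or.inr (Or.inr (Or.inr (Or.inl ⟨MulEquiv.ofBijective _ ⟨hi, ?_⟩⟩))))⟩
      intro w
      obtain ⟨i, j, rfl⟩ := q8_gen u x w hu (hnot x hx)
      exact ⟨⟨(u, 1) ^ (i : ℕ) * (x, c) ^ (j : ℕ),
        Q.mul_mem (Q.pow_mem huK _) (Q.pow_mem hg _)⟩, by simp⟩
  · have hinv : (MulEquiv.inv (Multiplicative (ZMod 4)) : MulAut _) ^ 2 ^ r = 1 := by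
      have h2 : (MulEquiv.inv (Multiplicative (ZMod 4)) : MulAut _) ^ 2 = 1 := by
        ext a; simp [pow_two]
      obtain ⟨s, rfl⟩ := Nat.exists_eq_add_of_le hr
      rw [pow_add, pow_mul, show (2 ^ 2 : ℕ) = 2 * 2 by norm_num, pow_mul, h2, one_pow, one_pow]
    have hφ1 : zh (2 ^ r) (MulEquiv.inv (Multiplicative (ZMod 4)) : MulAut _) hinv
        (Multiplicative.ofAdd (1 : ZMod (2 ^ r))) = MulEquiv.inv (Multiplicative (ZMod 4)) := by
      have := zh_cast (2 ^ r) (MulEquiv.inv (Multiplicative (ZMod 4)) : MulAut _) hinv 1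
      simpa using this
    refine ⟨r, Or.inr (Or.inr (Or.inr (Or.inr (Or.inr (Or.inr ⟨hr, _, hφ1, ?_⟩)))))⟩
    refine split Q _ hinj hr4 x c (2 ^ r) hg hgen hc (q8_pow x hx2 r hr) _ ?_
    intro k
    rw [hφ1]
    obtain ⟨z, rfl⟩ := exists_int 4 k
    rw [MulEquiv.inv_apply, map_inv, zh_cast, ← conj_zpow, hxu, inv_zpow]
end

section
/- Every proper subgroup of Q8 × Q8 is isomorphic to one of the following groups: the trivial group, C2, C4, C2 × C2, C4 × C2, C4 × C4, Q8, Q8 × C2, Q8 × C4, C4 ⋊ C4, or C4 ⋊ Q8. -/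
abbrev q8 := QuaternionGroup 2
abbrev GG := q8 × q8

theorem fin_iso {T : Type} [Group T] (Q : Subgroup GG) (F : T →* GG) (hF : ∀ t, F t ∈ Q)
    (hi : ∀ t, F t = 1 → t = 1) (hN : ∀ n, (n, 1) ∈ Q → ∃ t, F t = (n, 1))
    (hK : ∀ h k, (h, k) ∈ Q → ∃ t, (F t).2 = k) : Nonempty (Q ≃* T) := by
  refine ⟨(MulEquiv.ofBijective (F.codRestrict Q hF) ⟨?_, ?_⟩).symm⟩
  · rw [injective_iff_map_eq_one]
    intro t ht
    exact hi t (congrArg Subtype.val ht)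
  · rintro ⟨⟨h, k⟩, hq⟩
    obtain ⟨t, ht⟩ := hK h k hq
    have h1 : (h, k) * (F t)⁻¹ ∈ Q := Q.mul_mem hq (Q.inv_mem (hF t))
    have h2 : (h, k) * (F t)⁻¹ = (h * (F t).1⁻¹, 1) := by
      ext <;> simp [ht]
    rw [h2] at h1
    obtain ⟨u, hu⟩ := hN _ h1
    refine ⟨u * t, Subtype.ext ?_⟩
    change F (u * t) = (h, k)
    rw [map_mul, hu, ← h2]
    simp

theorem split_iso {A B T : Type} [Group A] [Group B] [Group T] (Q : Subgroup GG) (F : T →* GG)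
    (f : A →* q8) (s : B →* GG) (e : A → B → T) (he : ∀ t, ∃ a b, t = e a b)
    (he1 : e 1 1 = 1) (hF : ∀ a b, F (e a b) = (f a, 1) * s b)
    (hf : ∀ a, f a = 1 → a = 1) (hfQ : ∀ a, (f a, 1) ∈ Q) (hfN : ∀ n, (n, 1) ∈ Q → ∃ a, f a = n)
    (hs : ∀ b, s b ∈ Q) (hsi : ∀ b, (s b).2 = 1 → b = 1)
    (hsK : ∀ h k, (h, k) ∈ Q → ∃ b, (s b).2 = k) : Nonempty (Q ≃* T) := by
  refine fin_iso Q F ?_ ?_ ?_ ?_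
  · intro t
    obtain ⟨a, b, rfl⟩ := he t
    rw [hF]
    exact Q.mul_mem (hfQ a) (hs b)
  · intro t ht
    obtain ⟨a, b, rfl⟩ := he t
    rw [hF] at ht
    have h2 := congrArg Prod.snd ht
    simp only [Prod.snd_mul, one_mul, Prod.snd_one] at h2
    obtain rfl := hsi b h2
    have h1 := congrArg Prod.fst ht
    simp only [map_one, mul_one, Prod.fst_one] at h1
    obtain rfl := hf a h1
    exact he1
  · intro n hn
    obtain ⟨a, rfl⟩ := hfN n hn
    exact ⟨e a 1, by rw [hF]; simp⟩
  · intro h k hq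
    obtain ⟨b, rfl⟩ := hsK h k hq
    exact ⟨e 1 b, by rw [hF]; simp⟩

theorem split_prod_s4 {A B : Type} [Group A] [Group B] (Q : Subgroup GG)
    (f : A →* q8) (s : B →* GG) (hc : ∀ a b, Commute (f a) (s b).1)
    (hf : ∀ a, f a = 1 → a = 1) (hfQ : ∀ a, (f a, 1) ∈ Q) (hfN : ∀ n, (n, 1) ∈ Q → ∃ a, f a = n)
    (hs : ∀ b, s b ∈ Q) (hsi : ∀ b, (s b).2 = 1 → b = 1)
    (hsK : ∀ h k, (h, k) ∈ Q → ∃ b, (s b).2 = k) : Nonempty (Q ≃* A × B) := by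
  refine split_iso Q (MonoidHom.noncommCoprod ((MonoidHom.inl q8 q8).comp f) s ?_) f s
    (fun a b => (a, b)) (fun t => ⟨t.1, t.2, rfl⟩) rfl ?_ hf hfQ hfN hs hsi hsK
  · intro a b
    refine Prod.ext ?_ ?_
    · exact hc a b
    · change (1 : q8) * _ = _ * 1
      rw [one_mul, mul_one]
  · intro a b
    rfl

theorem split_semi {A B : Type} [Group A] [Group B] (Q : Subgroup GG) (φ : B →* MulAut A)
    (f : A →* q8) (s : B →* GG) (hc : ∀ a b, f (φ b a) = (s b).1 * f a * (s b).1⁻¹)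
    (hf : ∀ a, f a = 1 → a = 1) (hfQ : ∀ a, (f a, 1) ∈ Q) (hfN : ∀ n, (n, 1) ∈ Q → ∃ a, f a = n)
    (hs : ∀ b, s b ∈ Q) (hsi : ∀ b, (s b).2 = 1 → b = 1)
    (hsK : ∀ h k, (h, k) ∈ Q → ∃ b, (s b).2 = k) : Nonempty (Q ≃* A ⋊[φ] B) := by
  refine split_iso Q (SemidirectProduct.lift ((MonoidHom.inl q8 q8).comp f) s ?_) f s
    (fun a b => ⟨a, b⟩) (fun t => ⟨t.1, t.2, rfl⟩) rfl ?_ hf hfQ hfN hs hsi hsK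
  · intro b
    ext a <;> simp [hc]
  · intro a b
    rfl

/-- homomorphism out of a cyclic group -/
def cyc {M : Type} [Group M] (n : ℕ) [NeZero n] (x : M) (hx : x ^ n = 1) :
    Multiplicative (ZMod n) →* M :=
  MonoidHom.mk' (fun c => x ^ (c.toAdd : ZMod n).val) (by
    intro a b
    rw [toAdd_mul, ZMod.val_add, ← pow_add, ← pow_eq_pow_mod _ hx])

def qf {M : Type} [Group M] (p q : M) : q8 → M
  | .a i => p ^ (ZMod.val (n := 4) i)
  | .xa i => q * p ^ (ZMod.val (n := 4) i)

/-- homomorphism out of the quaternion group -/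
def qh {M : Type} [Group M] (p q : M) (h4 : p ^ 4 = 1) (h2 : q ^ 2 = p ^ 2)
    (hr : p * q = q * p⁻¹) : q8 →* M :=
  MonoidHom.mk' (qf p q) (by
    let C : ZMod 4 → M := fun i => p ^ i.val
    have hadd : ∀ i j, C (i + j) = C i * C j := fun i j => by
      simp only [C]
      rw [ZMod.val_add, ← pow_add, ← pow_eq_pow_mod _ h4]
    have h0 : C 0 = 1 := by simp [C]
    have hneg : ∀ i, C (-i) = (C i)⁻¹ := fun i => by
      rw [eq_inv_iff_mul_eq_one, ← hadd]; simp [h0]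
    have hC2 : C 2 = p ^ 2 := rfl
    have hq : ∀ i, C i * q = q * C (-i) := fun i => by
      rw [hneg]
      simp only [C]
      generalize i.val = m
      induction m with
      | zero => simp
      | succ m ih => rw [pow_succ, mul_assoc, hr, ← mul_assoc, ih]; group
    rintro (i | i) (j | j)
    · exact hadd i j
    · change q * C (j - i) = C i * (q * C j)
      rw [← mul_assoc, hq, mul_assoc, ← hadd]
      congr 2; ring
    · change q * C (i + j) = q * C i * C j
      rw [mul_assoc, hadd]
    · change C (2 + j - i) = q * C i * (q * C j)
      rw [mul_assoc, ← mul_assoc (C i), hq, mul_assoc, ← hadd, ← mul_assoc, ← sq q, h2, ← hC2, ← hadd]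
      congr 1; ring)

theorem qf_snd (p q : GG) (b : q8) : (qf p q b).2 = qf p.2 q.2 b := by
  cases b <;> simp [qf]

theorem qf_fst (p q : GG) (b : q8) : (qf p q b).1 = qf p.1 q.1 b := by
  cases b <;> simp [qf]

abbrev m1 : q8 := .a 2

def ind (p q : q8) : Prop := p ^ 2 = m1 ∧ q ^ 2 = m1 ∧ q ≠ p ∧ q ≠ p ^ 3
instance (p q : q8) : Decidable (ind p q) := by unfold ind; infer_instance

theorem qf_inj : ∀ p q : q8, ind p q → ∀ b, qf p q b = 1 → b = 1 := by decide +kernel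
theorem qf_surj : ∀ p q : q8, ind p q → ∀ k, ∃ b, qf p q b = k := by decide +kernel
theorem ind_rel : ∀ p q : q8, ind p q → p ^ 4 = 1 ∧ q ^ 2 = p ^ 2 ∧ p * q = q * p⁻¹ := by
  decide +kernel
theorem sq_one_or : ∀ n : q8, n = 1 ∨ n = m1 ∨ n ^ 2 = m1 := by decide +kernel
theorem pow4 : ∀ n : q8, n ^ 4 = 1 := by decide +kernel
theorem ne_of_pow : ∀ n : q8, n ^ 2 = m1 → ∀ c : ZMod 4, n ^ c.val = 1 → c = 0 := by decide +kernel

theorem sub_q8 (N : Subgroup q8) : (∀ n, n ∈ N ↔ n = 1) ∨ (∀ n, n ∈ N ↔ n = 1 ∨ n = m1) ∨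
    (∃ x, x ^ 2 = m1 ∧ ∀ n, n ∈ N ↔ ∃ c : ZMod 4, x ^ c.val = n) ∨ (∀ n, n ∈ N) := by
  by_cases h : ∃ x ∈ N, x ^ 2 = m1
  · obtain ⟨x, hx, hx2⟩ := h
    by_cases h' : ∃ y ∈ N, ind x y
    · right; right; right
      obtain ⟨y, hy, hxy⟩ := h'
      intro n
      obtain ⟨b, rfl⟩ := qf_surj x y hxy n
      cases b
      · exact N.pow_mem hx _
      · exact N.mul_mem hy (N.pow_mem hx _)
    · right; right; left
      refine ⟨x, hx2, fun n => ⟨fun hn => ?_, ?_⟩⟩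
      · have key : ∀ x n : q8, x ^ 2 = m1 → ¬ ind x n → ∃ c : ZMod 4, x ^ c.val = n := by
          decide +kernel
        exact key x n hx2 (fun hi => h' ⟨n, hn, hi⟩)
      · rintro ⟨c, rfl⟩
        exact N.pow_mem hx _
  · by_cases hm : m1 ∈ N
    · right; left
      intro n
      constructor
      · intro hn
        rcases sq_one_or n with h1 | h1 | h1
        · exact .inl h1
        · exact .inr h1
        · exact absurd ⟨n, hn, h1⟩ h
      · rintro (rfl | rfl)
        · exact N.one_mem
        · exact hm
    · left
      intro n
      constructor
      · intro hn
        rcases sq_one_or n with h1 | h1 | h1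
        · exact h1
        · exact absurd (h1 ▸ hn) hm
        · exact absurd ⟨n, hn, h1⟩ h
      · rintro rfl
        exact N.one_mem

theorem ind_ij : ind (.a 1) (.xa 0) := by decide +kernel
theorem m1sq : m1 ^ 2 = 1 := by decide +kernel
theorem one_m1_sq : m1 ^ 2 = (1 : q8) ^ 2 := by decide +kernel
theorem one_m1_rel : 1 * m1 = m1 * (1 : q8)⁻¹ := by decide +kernel
theorem sq_dich : ∀ h : q8, ¬ h ^ 2 = m1 → h ^ 2 = 1 := by decide +kernel

def GoodF {A : Type} [Group A] (Q : Subgroup GG) (f : A →* q8) : Prop :=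
  (∀ a, f a = 1 → a = 1) ∧ (∀ a, (f a, 1) ∈ Q) ∧ (∀ n, (n, 1) ∈ Q → ∃ a, f a = n)

def GoodS {B : Type} [Group B] (Q : Subgroup GG) (s : B →* GG) : Prop :=
  (∀ b, s b ∈ Q) ∧ (∀ b, (s b).2 = 1 → b = 1) ∧ (∀ h k, (h, k) ∈ Q → ∃ b, (s b).2 = k)

theorem iso_prod {A B : Type} [Group A] [Group B] {Q : Subgroup GG}
    {f : A →* q8} {s : B →* GG} (hf : GoodF Q f) (hs : GoodS Q s)
    (hc : ∀ a b, Commute (f a) (s b).1) : Nonempty (Q ≃* A × B) :=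
  split_prod_s4 Q f s hc hf.1 hf.2.1 hf.2.2 hs.1 hs.2.1 hs.2.2

theorem iso_semi {A B : Type} [Group A] [Group B] {Q : Subgroup GG} (φ : B →* MulAut A)
    {f : A →* q8} {s : B →* GG} (hf : GoodF Q f) (hs : GoodS Q s)
    (hc : ∀ a b, f (φ b a) = (s b).1 * f a * (s b).1⁻¹) : Nonempty (Q ≃* A ⋊[φ] B) :=
  split_semi Q φ f s hc hf.1 hf.2.1 hf.2.2 hs.1 hs.2.1 hs.2.2

theorem iso_left {A : Type} [Group A] {Q : Subgroup GG}
    {f : A →* q8} (hf : GoodF Q f) (hK : ∀ h k, (h, k) ∈ Q → k = 1) : Nonempty (Q ≃* A) := by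
  obtain ⟨e⟩ := iso_prod (B := Unit) (s := 1) hf
    ⟨fun b => Q.one_mem, fun b _ => rfl, fun h k hq => ⟨1, (hK h k hq).symm⟩⟩
    (fun a b => Commute.one_right _)
  exact ⟨e.trans MulEquiv.prodUnique⟩

theorem iso_right {B : Type} [Group B] {Q : Subgroup GG}
    {s : B →* GG} (hs : GoodS Q s) (hN : ∀ n, (n, 1) ∈ Q → n = 1) : Nonempty (Q ≃* B) := by
  obtain ⟨e⟩ := iso_prod (A := Unit) (f := 1)
    ⟨fun b _ => rfl, fun b => Q.one_mem, fun n hq => ⟨1, (hN n hq).symm⟩⟩ hs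
    (fun a b => Commute.one_left _)
  exact ⟨e.trans MulEquiv.uniqueProd⟩

theorem iso_swap {A B : Type} [Group A] [Group B] {Q : Subgroup GG}
    (h : Nonempty (Q ≃* A × B)) : Nonempty (Q ≃* B × A) :=
  ⟨h.some.trans MulEquiv.prodComm⟩

theorem goodF_one {Q : Subgroup GG} (hN : ∀ n, (n, 1) ∈ Q ↔ n = 1) :
    GoodF Q (cyc 1 (1 : q8) (one_pow _)) :=
  ⟨fun a _ => Subsingleton.elim _ _, fun a => by simp [cyc, hN],
    fun n hn => ⟨1, by rw [map_one, (hN n).1 hn]⟩⟩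

theorem goodF_two {Q : Subgroup GG} (hN : ∀ n, (n, 1) ∈ Q ↔ n = 1 ∨ n = m1) :
    GoodF Q (cyc 2 m1 (by decide)) := by
  refine ⟨by decide +kernel, fun a => (hN _).2 ?_, fun n hn => ?_⟩
  · revert a; decide +kernel
  · have := (hN n).1 hn
    clear hn
    revert n; decide +kernel

theorem goodF_four {Q : Subgroup GG} (x : q8) (hx : x ^ 2 = m1)
    (hN : ∀ n, (n, 1) ∈ Q ↔ ∃ c : ZMod 4, x ^ c.val = n) : GoodF Q (cyc 4 x (pow4 x)) :=
  ⟨fun a ha => ne_of_pow x hx a ha, fun a => (hN _).2 ⟨a, rfl⟩, fun n hn => (hN n).1 hn⟩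

theorem goodF_top {Q : Subgroup GG} (hN : ∀ n, (n, 1) ∈ Q) : GoodF Q (MonoidHom.id q8) :=
  ⟨fun a ha => ha, fun a => hN _, fun n hn => ⟨n, rfl⟩⟩

theorem goodS_two {Q : Subgroup GG} (g : GG) (hg : g ∈ Q) (h2 : g ^ 2 = 1) (hm : g.2 = m1)
    (hK : ∀ h k, (h, k) ∈ Q → k = 1 ∨ k = m1) : GoodS Q (cyc 2 g h2) := by
  refine ⟨fun b => Q.pow_mem hg _, fun b hb => ?_, fun h k hq => ?_⟩
  · change (g ^ (b.toAdd : ZMod 2).val).2 = 1 at hb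
    change g.2 ^ (b.toAdd : ZMod 2).val = 1 at hb
    rw [hm] at hb
    clear hK hm h2 hg
    revert b; decide +kernel
  · rcases hK h k hq with rfl | rfl
    · exact ⟨1, by simp⟩
    · exact ⟨Multiplicative.ofAdd 1, by
        change (g ^ 1).2 = m1
        rw [pow_one, hm]⟩

theorem gpow4 (g : GG) : g ^ 4 = 1 := Prod.ext (pow4 _) (pow4 _)

theorem goodS_four {Q : Subgroup GG} (g : GG) (hg : g ∈ Q) (hm : g.2 ^ 2 = m1)
    (hK : ∀ h k, (h, k) ∈ Q → ∃ c : ZMod 4, g.2 ^ c.val = k) : GoodS Q (cyc 4 g (gpow4 g)) :=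
  ⟨fun b => Q.pow_mem hg _, fun b hb => ne_of_pow g.2 hm b hb, fun h k hq => hK h k hq⟩

theorem goodS_q {Q : Subgroup GG} (p q : GG) (hp : p ∈ Q) (hq : q ∈ Q) (hi : ind p.2 q.2)
    (h2 : q ^ 2 = p ^ 2) (hr : p * q = q * p⁻¹) : GoodS Q (qh p q (gpow4 p) h2 hr) := by
  refine ⟨fun b => ?_, fun b hb => ?_, fun h k _ => ?_⟩
  · cases b
    · exact Q.pow_mem hp _
    · exact Q.mul_mem hq (Q.pow_mem hp _)
  · change (qf p q b).2 = 1 at hb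
    rw [qf_snd] at hb
    exact qf_inj _ _ hi b hb
  · obtain ⟨b, hb⟩ := qf_surj _ _ hi k
    exact ⟨b, (qf_snd p q b).trans hb⟩

abbrev Z4 := Multiplicative (ZMod 4)
abbrev Z2 := Multiplicative (ZMod 2)

theorem invpow4 : (MulEquiv.inv Z4 : MulAut Z4) ^ 4 = 1 := by
  ext x; revert x; decide +kernel

theorem invpow2 : (MulEquiv.inv Z4 : MulAut Z4) ^ 2 = 1 ^ 2 := by
  ext x; revert x; decide +kernel

def ρ4 : Z4 →* MulAut Z4 := cyc 4 (MulEquiv.inv Z4) invpow4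
def ρQ : q8 →* MulAut Z4 := qh 1 (MulEquiv.inv Z4) (one_pow _) invpow2 (by simp)

def Concl (Q : Subgroup GG) : Prop :=
    Nonempty (Q ≃* Multiplicative (ZMod 1)) ∨
    Nonempty (Q ≃* Z2) ∨
    Nonempty (Q ≃* Z4) ∨
    Nonempty (Q ≃* Z2 × Z2) ∨
    Nonempty (Q ≃* Z4 × Z2) ∨
    Nonempty (Q ≃* Z4 × Z4) ∨
    Nonempty (Q ≃* q8) ∨
    Nonempty (Q ≃* q8 × Z2) ∨
    Nonempty (Q ≃* q8 × Z4) ∨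
    Nonempty (Q ≃* Z4 ⋊[ρ4] Z4) ∨
    Nonempty (Q ≃* Z4 ⋊[ρQ] q8)

theorem concl_bot {Q : Subgroup GG} (hN : ∀ n, (n, 1) ∈ Q ↔ n = 1)
    (hK : (∀ k, (∃ h, (h, k) ∈ Q) ↔ k = 1) ∨ (∀ k, (∃ h, (h, k) ∈ Q) ↔ k = 1 ∨ k = m1) ∨
      (∃ x, x ^ 2 = m1 ∧ ∀ k, (∃ h, (h, k) ∈ Q) ↔ ∃ c : ZMod 4, x ^ c.val = k) ∨
      (∀ k, ∃ h, (h, k) ∈ Q)) : Concl Q := by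
  have hN' : ∀ g ∈ Q, g.2 = 1 → g = 1 := by
    rintro ⟨n, k⟩ hg rfl
    rw [(hN n).1 hg]; rfl
  unfold Concl
  rcases hK with hK | hK | ⟨k, hk, hK⟩ | hK
  · left
    exact iso_left (goodF_one hN) (fun h k hq => (hK k).1 ⟨h, hq⟩)
  · obtain ⟨h, hq⟩ := (hK m1).2 (.inr rfl)
    have := iso_right (goodS_two (h, m1) hq (hN' _ (Q.pow_mem hq 2) (by
      change m1 ^ 2 = 1; decide)) rfl (fun h k hq => (hK k).1 ⟨h, hq⟩)) (fun n => (hN n).1)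
    tauto
  · obtain ⟨h, hq⟩ := (hK k).2 ⟨1, pow_one k⟩
    have := iso_right (goodS_four (h, k) hq hk (fun h k hq => (hK k).1 ⟨h, hq⟩))
      (fun n => (hN n).1)
    tauto
  · obtain ⟨h1, hq1⟩ := hK (.a 1)
    obtain ⟨h2, hq2⟩ := hK (.xa 0)
    have e1 := hN' _ (Q.mul_mem (Q.pow_mem hq2 2) (Q.inv_mem (Q.pow_mem hq1 2))) (by
      change (QuaternionGroup.xa 0 : q8) ^ 2 * ((QuaternionGroup.a 1) ^ 2)⁻¹ = 1
      decide +kernel)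
    have e2 := hN' _ (Q.mul_mem (Q.mul_mem hq1 hq2)
      (Q.inv_mem (Q.mul_mem hq2 (Q.inv_mem hq1)))) (by
      change (QuaternionGroup.a 1 : q8) * (.xa 0) *
        (.xa 0 * (QuaternionGroup.a 1)⁻¹)⁻¹ = 1
      decide +kernel)
    have := iso_right (goodS_q _ _ hq1 hq2 ind_ij
      (mul_inv_eq_one.1 e1) (mul_inv_eq_one.1 e2)) (fun n => (hN n).1)
    tauto

theorem comm_m1 : ∀ (a : Z2) (x : q8), Commute (cyc 2 m1 (by decide) a) x := by
  unfold Commute SemiconjBy; decide +kernel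

/-- the non-split dichotomy over `K = Q8` -/
theorem dich {Q : Subgroup GG} (hm : (m1, 1) ∈ Q) (hK : ∀ k, ∃ h, (h, k) ∈ Q) :
    ((1, .a 1) ∈ Q ∧ (1, .xa 0) ∈ Q) ∨ (∃ h1 h2, ind h1 h2 ∧ (h1, .a 1) ∈ Q ∧ (h2, .xa 0) ∈ Q) ∨
    (∃ h p q, ind p q ∧ h ^ 2 = m1 ∧ (1, p) ∈ Q ∧ (h, q) ∈ Q) := by
  obtain ⟨h1, hq1⟩ := hK (.a 1)
  obtain ⟨h2, hq2⟩ := hK (.xa 0)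
  have key : ∀ h1 h2 : q8, ind h1 h2 ∨ ((h1 = 1 ∨ m1 * h1 = 1) ∧ (h2 = 1 ∨ m1 * h2 = 1)) ∨
      ((h1 = 1 ∨ m1 * h1 = 1) ∧ h2 ^ 2 = m1) ∨ ((h2 = 1 ∨ m1 * h2 = 1) ∧ h1 ^ 2 = m1) ∨
      ((h1 * h2 = 1 ∨ m1 * (h1 * h2) = 1) ∧ h1 ^ 2 = m1) := by decide +kernel
  have fix : ∀ {h k : q8}, (h, k) ∈ Q → (h = 1 ∨ m1 * h = 1) → (1, k) ∈ Q := by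
    rintro h k hq (rfl | h1)
    · exact hq
    · have := Q.mul_mem hm hq
      rwa [Prod.mk_mul_mk, h1, one_mul] at this
  have h12 := Q.mul_mem hq1 hq2
  rw [Prod.mk_mul_mk] at h12
  rcases key h1 h2 with h | ⟨ha, hb⟩ | ⟨ha, hb⟩ | ⟨ha, hb⟩ | ⟨ha, hb⟩
  · exact .inr (.inl ⟨h1, h2, h, hq1, hq2⟩)
  · exact .inl ⟨fix hq1 ha, fix hq2 hb⟩
  · exact .inr (.inr ⟨h2, _, _, by decide +kernel, hb, fix hq1 ha, hq2⟩)
  · exact .inr (.inr ⟨h1, _, _, by decide +kernel, hb, fix hq2 ha, hq1⟩)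
  · exact .inr (.inr ⟨h1, _, _, by decide +kernel, hb, fix h12 ha, hq1⟩)

theorem concl_two {Q : Subgroup GG} (hN : ∀ n, (n, 1) ∈ Q ↔ n = 1 ∨ n = m1)
    (hK : (∀ k, (∃ h, (h, k) ∈ Q) ↔ k = 1) ∨ (∀ k, (∃ h, (h, k) ∈ Q) ↔ k = 1 ∨ k = m1) ∨
      (∃ x, x ^ 2 = m1 ∧ ∀ k, (∃ h, (h, k) ∈ Q) ↔ ∃ c : ZMod 4, x ^ c.val = k) ∨
      (∀ k, ∃ h, (h, k) ∈ Q)) : Concl Q := by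
  have hm : (m1, 1) ∈ Q := (hN m1).2 (.inr rfl)
  unfold Concl
  rcases hK with hK | hK | ⟨k, hk, hK⟩ | hK
  · have := iso_left (goodF_two hN) (fun h k hq => (hK k).1 ⟨h, hq⟩)
    tauto
  · obtain ⟨h, hq⟩ := (hK m1).2 (.inr rfl)
    by_cases hh : h ^ 2 = m1
    · have : Nonempty (Q ≃* Z4) := by
        refine fin_iso Q (cyc 4 (h, m1) (gpow4 _)) (fun t => Q.pow_mem hq _) ?_ ?_ ?_
        · intro t ht
          exact ne_of_pow h hh t (congrArg Prod.fst ht)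
        · intro n hn
          rcases (hN n).1 hn with rfl | rfl
          · exact ⟨1, map_one _⟩
          · exact ⟨Multiplicative.ofAdd 2, Prod.ext hh m1sq⟩
        · intro h' k hq'
          rcases (hK k).1 ⟨_, hq'⟩ with rfl | rfl
          · exact ⟨1, by rw [map_one]; rfl⟩
          · exact ⟨Multiplicative.ofAdd 1, pow_one m1⟩
      tauto
    · have h2 : h ^ 2 = 1 := sq_dich h hh
      have := iso_prod (goodF_two hN) (goodS_two (h, m1) hq (Prod.ext h2 m1sq) rfl
        (fun h k hq => (hK k).1 ⟨h, hq⟩)) (fun a b => comm_m1 a _)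
      tauto
  · obtain ⟨h, hq⟩ := (hK k).2 ⟨1, pow_one k⟩
    have := iso_swap (iso_prod (goodF_two hN)
      (goodS_four (h, k) hq hk (fun h k hq => (hK k).1 ⟨h, hq⟩)) (fun a b => comm_m1 a _))
    tauto
  · rcases dich hm hK with ⟨hq1, hq2⟩ | ⟨h1, h2, hi, hq1, hq2⟩ | ⟨h, p, q, hi, hh, hp, hq⟩
    · have := iso_swap (iso_prod (goodF_two hN) (goodS_q _ _ hq1 hq2 (by decide +kernel)
        (by decide +kernel) (by decide +kernel)) (fun a b => comm_m1 a _))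
      tauto
    · have hr := ind_rel _ _ hi
      have := iso_swap (iso_prod (goodF_two hN) (goodS_q _ _ hq1 hq2 ind_ij
        (Prod.ext hr.2.1 (ind_rel _ _ ind_ij).2.1) (Prod.ext hr.2.2 (ind_rel _ _ ind_ij).2.2))
        (fun a b => comm_m1 a _))
      tauto
    · have hr := ind_rel _ _ hi
      have hpc : ∀ c : Z4, cyc 4 ((1, p) : GG) (gpow4 _) (c⁻¹) =
          (cyc 4 ((1, p) : GG) (gpow4 _) c)⁻¹ := fun c => map_inv _ c
      let F : Z4 ⋊[ρ4] Z4 →* GG := SemidirectProduct.lift (cyc 4 ((1, p) : GG) (gpow4 _))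
        (cyc 4 ((h, q) : GG) (gpow4 _)) (by
          have key : ∀ h p q : q8, ind p q → ∀ a b : Z4,
              p ^ (ZMod.val (n := 4) (Multiplicative.toAdd (ρ4 b a))) =
              q ^ (ZMod.val (n := 4) b.toAdd) * p ^ (ZMod.val (n := 4) a.toAdd) *
              (q ^ (ZMod.val (n := 4) b.toAdd))⁻¹ := by decide +kernel
          intro b
          ext a
          · simp [cyc]
          · exact key h p q hi (Multiplicative.ofAdd a) b)
      have hF : ∀ a b : Z4, F ⟨a, b⟩ = ((1, p) : GG) ^ (ZMod.val (n := 4) a.toAdd) *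
        ((h, q) : GG) ^ (ZMod.val (n := 4) b.toAdd) := fun a b => rfl
      have hF1 : ∀ a b : Z4, (F ⟨a, b⟩).1 = h ^ (ZMod.val (n := 4) b.toAdd) := fun a b => by
        rw [hF]; simp
      have hF2 : ∀ a b : Z4, (F ⟨a, b⟩).2 = p ^ (ZMod.val (n := 4) a.toAdd) *
          q ^ (ZMod.val (n := 4) b.toAdd) := fun a b => by
        rw [hF]; simp
      have : Nonempty (Q ≃* Z4 ⋊[ρ4] Z4) := by
        refine fin_iso Q F ?_ ?_ ?_ ?_
        · rintro ⟨a, b⟩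
          rw [hF]
          exact Q.mul_mem (Q.pow_mem hp _) (Q.pow_mem hq _)
        · rintro ⟨a, b⟩ ht
          have e1 := hF1 a b
          rw [ht] at e1
          obtain rfl : b = 1 := ne_of_pow h hh b e1.symm
          have e2 := hF2 a 1
          rw [ht] at e2
          obtain rfl : a = 1 := ne_of_pow p hi.1 a (by rw [hF] at ht; exact (mul_one _).symm.trans (congrArg Prod.snd ht))
          rfl
        · intro n hn
          rcases (hN n).1 hn with rfl | rfl
          · exact ⟨1, map_one _⟩
          · refine ⟨⟨Multiplicative.ofAdd 2, Multiplicative.ofAdd 2⟩, Prod.ext ?_ ?_⟩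
            · rw [hF1]; exact hh
            · rw [hF2]
              change p ^ 2 * q ^ 2 = 1
              rw [hi.1, hi.2.1]; decide +kernel
        · intro h' k hk
          have key : ∀ p q : q8, ind p q → ∀ k, ∃ a b : Z4, p ^ (ZMod.val (n := 4) a.toAdd) *
            q ^ (ZMod.val (n := 4) b.toAdd) = k := by decide +kernel
          obtain ⟨a, b, hab⟩ := key p q hi k
          exact ⟨⟨a, b⟩, (hF2 a b).trans hab⟩
      tauto

theorem comm_pow {x y : q8} (h : Commute x y) (a : Z4) : Commute (cyc 4 x (pow4 x) a) y :=
  Commute.pow_left h _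

theorem concl_four {Q : Subgroup GG} (x : q8) (hx : x ^ 2 = m1)
    (hN : ∀ n, (n, 1) ∈ Q ↔ ∃ c : ZMod 4, x ^ c.val = n)
    (hK : (∀ k, (∃ h, (h, k) ∈ Q) ↔ k = 1) ∨ (∀ k, (∃ h, (h, k) ∈ Q) ↔ k = 1 ∨ k = m1) ∨
      (∃ x, x ^ 2 = m1 ∧ ∀ k, (∃ h, (h, k) ∈ Q) ↔ ∃ c : ZMod 4, x ^ c.val = k) ∨
      (∀ k, ∃ h, (h, k) ∈ Q)) : Concl Q := by
  have hxQ : (x, 1) ∈ Q := (hN x).2 ⟨1, pow_one x⟩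
  have hm : (m1, 1) ∈ Q := (hN m1).2 ⟨2, hx⟩
  have d : ∀ {h k : q8}, (h, k) ∈ Q → (1, k) ∈ Q ∨ ind x h := by
    intro h k hq
    by_cases hi : ind x h
    · exact .inr hi
    · have key : ∀ x n : q8, x ^ 2 = m1 → ¬ ind x n → ∃ c : ZMod 4, x ^ c.val = n := by
        decide +kernel
      have := Q.mul_mem (Q.inv_mem ((hN h).2 (key x h hx hi))) hq
      left
      simpa using this
  unfold Concl
  rcases hK with hK | hK | ⟨k, hk, hK⟩ | hK
  · have := iso_left (goodF_four x hx hN) (fun h k hq => (hK k).1 ⟨h, hq⟩)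
    tauto
  · obtain ⟨h, hq⟩ := (hK m1).2 (.inr rfl)
    rcases d hq with hq | hi
    · have := iso_prod (goodF_four x hx hN) (goodS_two (1, m1) hq (by decide +kernel) rfl
        (fun h k hq => (hK k).1 ⟨h, hq⟩)) (fun a b => comm_pow (by
          revert b; intro b; exact (Commute.one_right x).pow_right _ |>.trans (by simp [cyc])) a)
      tauto
    · have hr := ind_rel _ _ hi
      have : Nonempty (Q ≃* q8) := by
        refine fin_iso Q (qh ((x, 1) : GG) (h, m1) (gpow4 _) (Prod.ext hr.2.1 one_m1_sq)
          (Prod.ext hr.2.2 one_m1_rel)) ?_ ?_ ?_ ?_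
        · rintro (b | b)
          · exact Q.pow_mem hxQ _
          · exact Q.mul_mem hq (Q.pow_mem hxQ _)
        · intro t ht
          have := congrArg Prod.fst ht
          exact qf_inj _ _ hi t ((qf_fst _ _ t).symm.trans this)
        · intro n hn
          obtain ⟨c, rfl⟩ := (hN n).1 hn
          exact ⟨.a c, Prod.ext (qf_fst _ _ _) ((qf_snd _ _ _).trans (one_pow _))⟩
        · intro h' k hq'
          rcases (hK k).1 ⟨_, hq'⟩ with rfl | rfl
          · exact ⟨1, by rw [map_one]; rfl⟩
          · exact ⟨.xa 0, (qf_snd _ _ _).trans (mul_one _)⟩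
      tauto
  · obtain ⟨h, hq⟩ := (hK k).2 ⟨1, pow_one k⟩
    have hS := fun (h : q8) hq => goodS_four (Q := Q) (h, k) hq hk
      (fun h k hq => (hK k).1 ⟨h, hq⟩)
    rcases d hq with hq | hi
    · have := iso_prod (goodF_four x hx hN) (hS _ hq) (fun a b => comm_pow (by
          simp [cyc]) a)
      tauto
    · have := iso_semi ρ4 (goodF_four x hx hN) (hS _ hq) (by
        intro a b
        change x ^ (ZMod.val (n := 4) (Multiplicative.toAdd (ρ4 b a))) =
              h ^ (ZMod.val (n := 4) b.toAdd) * x ^ (ZMod.val (n := 4) a.toAdd) *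
              (h ^ (ZMod.val (n := 4) b.toAdd))⁻¹
        clear d hN hm hxQ hK hS hq hx
        revert x h a b
        decide +kernel)
      tauto
  · have main : ∀ h p q, ind p q → ind x h → (1, p) ∈ Q → (h, q) ∈ Q →
        Nonempty (Q ≃* Z4 ⋊[ρQ] q8) := by
      intro h p q hpq hi hp hq
      have hr := ind_rel _ _ hi
      have hr' := ind_rel _ _ hpq
      have hp' : (x, p) ∈ Q := by simpa using Q.mul_mem hxQ hp
      refine iso_semi ρQ (goodF_four x hx hN) (goodS_q (x, p) (h, q) hp' hq hpq
        (Prod.ext hr.2.1 hr'.2.1) (Prod.ext hr.2.2 hr'.2.2)) ?_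
      intro a b
      change x ^ (ZMod.val (n := 4) (Multiplicative.toAdd (ρQ b a))) =
        (qf (x, p) (h, q) b).1 * x ^ (ZMod.val (n := 4) a.toAdd) * (qf (x, p) (h, q) b).1⁻¹
      rw [qf_fst]
      have key : ∀ x h : q8, ind x h → ∀ a b, 
        x ^ (ZMod.val (n := 4) (Multiplicative.toAdd (ρQ b a))) =
        (qf x h b) * x ^ (ZMod.val (n := 4) a.toAdd) * (qf x h b)⁻¹ := by decide +kernel
      exact key x h hi a b
    obtain ⟨h1, hq1⟩ := hK (.a 1)
    obtain ⟨h2, hq2⟩ := hK (.xa 0)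
    have h12 := Q.mul_mem hq1 hq2
    rw [Prod.mk_mul_mk] at h12
    have k12 : ∀ x h1 h2 : q8, ind x h1 → ind x h2 → ¬ ind x (h1 * h2) := by decide +kernel
    have fin : ∀ hS : Nonempty (Q ≃* Z4 ⋊[ρQ] q8), Concl Q := by
      intro hS; unfold Concl; tauto
    rcases d hq1 with a1 | a1 <;> rcases d hq2 with a2 | a2
    · have := iso_swap (iso_prod (goodF_four x hx hN) (goodS_q _ _ a1 a2 (by decide +kernel)
        (by decide +kernel) (by decide +kernel)) (fun a b => comm_pow (by
          change Commute x (qf ((1, .a 1) : GG) ((1, .xa 0) : GG) b).1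
          rw [qf_fst]
          cases b <;> simp [qf]) a))
      tauto
    · exact fin (main h2 _ _ (by decide +kernel) a2 a1 hq2)
    · exact fin (main h1 _ _ (by decide +kernel) a1 a2 hq1)
    · rcases d h12 with a3 | a3
      · exact fin (main h1 _ _ (by decide +kernel) a1 a3 hq1)
      · exact absurd a3 (k12 _ _ _ a1 a2)

theorem concl_top {Q : Subgroup GG} (hQ : Q ≠ ⊤) (hN : ∀ n, (n, 1) ∈ Q)
    (hK : (∀ k, (∃ h, (h, k) ∈ Q) ↔ k = 1) ∨ (∀ k, (∃ h, (h, k) ∈ Q) ↔ k = 1 ∨ k = m1) ∨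
      (∃ x, x ^ 2 = m1 ∧ ∀ k, (∃ h, (h, k) ∈ Q) ↔ ∃ c : ZMod 4, x ^ c.val = k) ∨
      (∀ k, ∃ h, (h, k) ∈ Q)) : Concl Q := by
  have d : ∀ {h k : q8} (g : q8), (h, k) ∈ Q → (g, k) ∈ Q := by
    intro h k g hq
    simpa using Q.mul_mem (hN (g * h⁻¹)) hq
  unfold Concl
  rcases hK with hK | hK | ⟨k, hk, hK⟩ | hK
  · have := iso_left (goodF_top hN) (fun h k hq => (hK k).1 ⟨h, hq⟩)
    tauto
  · obtain ⟨h, hq⟩ := (hK m1).2 (.inr rfl)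
    have := iso_prod (goodF_top hN) (goodS_two (1, m1) (d 1 hq) (by decide +kernel) rfl
      (fun h k hq => (hK k).1 ⟨h, hq⟩)) (fun a b => by simp [cyc])
    tauto
  · obtain ⟨h, hq⟩ := (hK k).2 ⟨1, pow_one k⟩
    have := iso_prod (goodF_top hN) (goodS_four (1, k) (d 1 hq) hk
      (fun h k hq => (hK k).1 ⟨h, hq⟩)) (fun a b => by simp [cyc])
    tauto
  · refine absurd ?_ hQ
    rw [eq_top_iff]
    rintro ⟨h, k⟩ -
    obtain ⟨g, hg⟩ := hK k
    exact d h hg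

theorem concl (Q : Subgroup GG) (hQ : Q ≠ ⊤) : Concl Q := by
  have hK := sub_q8 (Q.map (MonoidHom.snd q8 q8))
  have e : ∀ k, k ∈ Q.map (MonoidHom.snd q8 q8) ↔ ∃ h, (h, k) ∈ Q := by
    intro k; simp [Subgroup.mem_map]
  simp only [e] at hK
  rcases sub_q8 (Q.comap (MonoidHom.inl q8 q8)) with hN | hN | ⟨x, hx, hN⟩ | hN
  · exact concl_bot hN hK
  · exact concl_two hN hK
  · exact concl_four x hx hN hK
  · exact concl_top hQ hN hK

/-- Every proper subgroup of `Q8 × Q8` is isomorphic to one of: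
the trivial group, `C2`, `C4`, `C2 × C2`, `C4 × C2`, `C4 × C4`, `Q8`, `Q8 × C2`,
`Q8 × C4`, `C4 ⋊ C4` (generator of the acting `C4` acts by inversion), or `C4 ⋊ Q8`
(`i ∈ Q8` acts trivially, `j` acts by inversion). -/
theorem stmt4 (Q : Subgroup (QuaternionGroup 2 × QuaternionGroup 2)) (hQ : Q ≠ ⊤) :
    Nonempty (Q ≃* Multiplicative (ZMod 1)) ∨
    Nonempty (Q ≃* Multiplicative (ZMod 2)) ∨
    Nonempty (Q ≃* Multiplicative (ZMod 4)) ∨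
    Nonempty (Q ≃* Multiplicative (ZMod 2) × Multiplicative (ZMod 2)) ∨
    Nonempty (Q ≃* Multiplicative (ZMod 4) × Multiplicative (ZMod 2)) ∨
    Nonempty (Q ≃* Multiplicative (ZMod 4) × Multiplicative (ZMod 4)) ∨
    Nonempty (Q ≃* QuaternionGroup 2) ∨
    Nonempty (Q ≃* QuaternionGroup 2 × Multiplicative (ZMod 2)) ∨
    Nonempty (Q ≃* QuaternionGroup 2 × Multiplicative (ZMod 4)) ∨
    (∃ φ : Multiplicative (ZMod 4) →* MulAut (Multiplicative (ZMod 4)),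
      φ (Multiplicative.ofAdd (1 : ZMod 4)) = MulEquiv.inv (Multiplicative (ZMod 4)) ∧
      Nonempty (Q ≃* (Multiplicative (ZMod 4)) ⋊[φ] (Multiplicative (ZMod 4)))) ∨
    (∃ φ : QuaternionGroup 2 →* MulAut (Multiplicative (ZMod 4)),
      φ (QuaternionGroup.a 1) = 1 ∧
      φ (QuaternionGroup.xa 0) = MulEquiv.inv (Multiplicative (ZMod 4)) ∧
      Nonempty (Q ≃* (Multiplicative (ZMod 4)) ⋊[φ] (QuaternionGroup 2))) := by
  have h1 : ρ4 (Multiplicative.ofAdd (1 : ZMod 4)) = MulEquiv.inv (Multiplicative (ZMod 4)) :=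
    pow_one _
  have h2 : ρQ (QuaternionGroup.a 1) = 1 := one_pow _
  have h3 : ρQ (QuaternionGroup.xa 0) = MulEquiv.inv (Multiplicative (ZMod 4)) := mul_one _
  rcases concl Q hQ with h | h | h | h | h | h | h | h | h | h | h
  · exact .inl h
  · exact .inr (.inl h)
  · exact .inr (.inr (.inl h))
  · exact .inr (.inr (.inr (.inl h)))
  · exact .inr (.inr (.inr (.inr (.inl h))))
  · exact .inr (.inr (.inr (.inr (.inr (.inl h)))))
  · exact .inr (.inr (.inr (.inr (.inr (.inr (.inl h))))))
  · exact .inr (.inr (.inr (.inr (.inr (.inr (.inr (.inl h)))))))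
  · exact .inr (.inr (.inr (.inr (.inr (.inr (.inr (.inr (.inl h))))))))
  · exact .inr (.inr (.inr (.inr (.inr (.inr (.inr (.inr (.inr (.inl ⟨ρ4, h1, h⟩)))))))))
  · exact .inr (.inr (.inr (.inr (.inr (.inr (.inr (.inr (.inr (.inr ⟨ρQ, h2, h3, h⟩)))))))))
end

section
/- The automorphism group Aut(Q8 × Q8) is a {2,3}-group with Sylow 3-subgroup isomorphic to C3 × C3; that is, there exists a natural number a with |Aut(Q8 × Q8)| = 9 · 2^a, and every Sylow 3-subgroup of Aut(Q8 × Q8) is isomorphic to C3 × C3. -/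
namespace QQ

abbrev Q := QuaternionGroup 2
abbrev G := Q × Q
abbrev S := Bool × Fin 3

/-- The underlying map of the order three automorphism of the quaternion group. -/
def sigmaFun : Q → Q
  | .a i => (QuaternionGroup.xa 0) ^ i.val
  | .xa i => QuaternionGroup.xa 3 * (QuaternionGroup.xa 0) ^ i.val

def sigma : MulAut Q where
  toFun := sigmaFun
  invFun := fun x => sigmaFun (sigmaFun x)
  left_inv := by decide
  right_inv := by decide
  map_mul' := by decide

lemma sigma_pow_three : sigma ^ 3 = 1 := by
  ext x
  revert x
  decide

def sigmaHom : Multiplicative (ZMod 3) →* MulAut Q where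
  toFun k := sigma ^ (k.toAdd.val)
  map_one' := by simp
  map_mul' x y := by
    rw [toAdd_mul, ZMod.val_add, ← pow_add]
    exact (pow_eq_pow_mod _ sigma_pow_three).symm

lemma sigmaHom_inj : ∀ k : Multiplicative (ZMod 3),
    sigmaHom k (QuaternionGroup.a 1) = QuaternionGroup.a 1 → k = 1 := by
  decide

def psi : Multiplicative (ZMod 3) × Multiplicative (ZMod 3) →* MulAut G where
  toFun k := MulEquiv.prodCongr (sigmaHom k.1) (sigmaHom k.2)
  map_one' := by
    refine MulEquiv.ext fun z => ?_
    show (sigmaHom 1 z.1, sigmaHom 1 z.2) = z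
    simp
  map_mul' x y := by
    refine MulEquiv.ext fun z => ?_
    show (sigmaHom (x.1 * y.1) z.1, sigmaHom (x.2 * y.2) z.2) =
      (sigmaHom x.1 (sigmaHom y.1 z.1), sigmaHom x.2 (sigmaHom y.2 z.2))
    simp

lemma psi_inj : Function.Injective psi := by
  rw [injective_iff_map_eq_one]
  intro k hk
  have h := DFunLike.congr_fun hk (QuaternionGroup.a 1, QuaternionGroup.a 1)
  have h' := Prod.ext_iff.1 h
  exact Prod.ext (sigmaHom_inj _ h'.1) (sigmaHom_inj _ h'.2)

/-- Representatives of the three noncentral cosets in a factor. -/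
def rep0 : Fin 3 → Q := ![.a 1, .xa 0, .xa 1]

def rep (s : S) : G := if s.1 then (rep0 s.2, 1) else (1, rep0 s.2)

/-- Centrality. -/
def Z {H : Type*} [Group H] (g : H) : Prop := ∀ h, g * h = h * g

instance : DecidablePred (Z (H := Q)) := fun _ => by unfold Z; infer_instance

/-- Noncentral with nonabelian centralizer. -/
def T (g : G) : Prop := ¬ Z g ∧ ∃ h k, g * h = h * g ∧ g * k = k * g ∧ h * k ≠ k * h

lemma Z_prod (g : G) : Z g ↔ Z g.1 ∧ Z g.2 := by
  constructor
  · intro h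
    exact ⟨fun x => congrArg Prod.fst (h (x, 1)), fun x => congrArg Prod.snd (h (1, x))⟩
  · rintro ⟨h1, h2⟩ x
    exact Prod.ext (h1 _) (h2 _)

lemma Z_map (f : MulAut G) {g : G} (h : Z g) : Z (f g) := by
  intro x
  obtain ⟨y, rfl⟩ := f.surjective x
  rw [← map_mul, h, map_mul]

lemma T_map (f : MulAut G) {g : G} (h : T g) : T (f g) := by
  obtain ⟨h1, a, b, h2, h3, h4⟩ := h
  refine ⟨fun h => h1 ?_, f a, f b, ?_, ?_, ?_⟩
  · have := Z_map f⁻¹ h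
    simpa using this
  · rw [← map_mul, h2, map_mul]
  · rw [← map_mul, h3, map_mul]
  · rw [← map_mul, ← map_mul]
    exact fun h => h4 (f.injective h)

lemma Z_one {H : Type*} [Group H] : Z (1 : H) := fun _ => by simp

lemma Z_mul {H : Type*} [Group H] {a b : H} (ha : Z a) (hb : Z b) : Z (a * b) := fun h => by
  rw [mul_assoc, hb, ← mul_assoc, ha, mul_assoc]

lemma Z_inv {H : Type*} [Group H] {a : H} (ha : Z a) : Z a⁻¹ := fun h => by
  rw [inv_mul_eq_iff_eq_mul, ← mul_assoc, ha, mul_assoc, mul_inv_cancel, mul_one]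

lemma comm_q : ∀ g : Q, ¬ Z g → ∀ h k : Q, g * h = h * g → g * k = k * g → h * k = k * h := by
  decide

lemma rep0_ex : ∀ g : Q, ¬ Z g → ∃ i, Z (g⁻¹ * rep0 i) := by decide

lemma T_ex {g : G} (h : T g) : ∃ s, Z (g⁻¹ * rep s) := by
  obtain ⟨h1, a, b, h2, h3, h4⟩ := h
  by_cases ha : Z g.1
  · have hb : ¬ Z g.2 := fun hb => h1 ((Z_prod g).2 ⟨ha, hb⟩)
    obtain ⟨i, hi⟩ := rep0_ex _ hb
    exact ⟨(false, i), (Z_prod _).2 ⟨by simpa [rep] using Z_inv ha, by simpa [rep] using hi⟩⟩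
  · by_cases hb : Z g.2
    · obtain ⟨i, hi⟩ := rep0_ex _ ha
      exact ⟨(true, i), (Z_prod _).2 ⟨by simpa [rep] using hi, by simpa [rep] using Z_inv hb⟩⟩
    · refine absurd (Prod.ext ?_ ?_) h4
      · exact comm_q _ ha _ _ (congrArg Prod.fst h2) (congrArg Prod.fst h3)
      · exact comm_q _ hb _ _ (congrArg Prod.snd h2) (congrArg Prod.snd h3)

lemma rep_uniq' : ∀ s t : S, Z ((rep s)⁻¹ * rep t).1 → Z ((rep s)⁻¹ * rep t).2 → s = t := by
  decide

lemma rep_uniq {s t : S} (h : Z ((rep s)⁻¹ * rep t)) : s = t :=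
  rep_uniq' s t ((Z_prod _).1 h).1 ((Z_prod _).1 h).2

lemma rep0_nc : ∀ i, ¬ Z (rep0 i) := by decide

lemma T_rep (s : S) : T (rep s) := by
  obtain ⟨b, i⟩ := s
  cases b
  · refine ⟨fun h => rep0_nc i ((Z_prod _).1 h).2,
      (.a 1, 1), (.xa 0, 1), ?_, ?_, ?_⟩
    · simp [rep]
    · simp [rep]
    · decide
  · refine ⟨fun h => rep0_nc i ((Z_prod _).1 h).1,
      (1, .a 1), (1, .xa 0), ?_, ?_, ?_⟩
    · simp [rep]
    · simp [rep]
    · decide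

noncomputable def act (f : MulAut G) (s : S) : S := (T_ex (T_map f (T_rep s))).choose

lemma act_spec (f : MulAut G) (s : S) : Z ((f (rep s))⁻¹ * rep (act f s)) :=
  (T_ex (T_map f (T_rep s))).choose_spec

lemma act_eq {f : MulAut G} {s t : S} (h : Z ((f (rep s))⁻¹ * rep t)) : act f s = t := by
  apply rep_uniq
  have := Z_mul (Z_inv (act_spec f s)) h
  simpa [mul_assoc] using this

noncomputable instance : MulAction (MulAut G) S where
  smul := act
  one_smul s := act_eq (by simpa using Z_one)
  mul_smul f g s := act_eq (t := act f (act g s)) (by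
    have h1 := Z_map f (act_spec g s)
    have h2 := act_spec f (act g s)
    have := Z_mul h1 h2
    simpa [mul_assoc] using this)

/-- Permutations of `S` preserving the two blocks. -/
def K : Subgroup (Equiv.Perm S) where
  carrier := {p | ∀ s t : S, s.1 = t.1 ↔ (p s).1 = (p t).1}
  one_mem' := fun _ _ => Iff.rfl
  mul_mem' := fun {a b} ha hb s t => (hb s t).trans (ha _ _)
  inv_mem' := fun {a} ha s t => by
    have := ha (a⁻¹ s) (a⁻¹ t)
    simpa using this.symm

lemma rep_comm : ∀ s t : S, s.1 = t.1 ↔ (s = t ∨ rep s * rep t ≠ rep t * rep s) := by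
  decide

lemma comm_congr {a b c d : G} (h1 : Z (a⁻¹ * c)) (h2 : Z (b⁻¹ * d)) (h : a * b = b * a) :
    c * d = d * c := by
  obtain ⟨z, rfl⟩ : ∃ z, c = a * z := ⟨a⁻¹ * c, by simp⟩
  obtain ⟨w, rfl⟩ : ∃ w, d = b * w := ⟨b⁻¹ * d, by simp⟩
  simp only [inv_mul_cancel_left] at h1 h2
  calc a * z * (b * w) = a * (z * (b * w)) := by group
    _ = a * (b * w * z) := by rw [h1]
    _ = a * b * (w * z) := by group
    _ = b * (a * (w * z)) := by rw [h]; group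
    _ = b * (a * w * z) := by group
    _ = b * (w * a * z) := by rw [h2 a]
    _ = _ := by group

lemma comm_congr_iff {a b c d : G} (h1 : Z (a⁻¹ * c)) (h2 : Z (b⁻¹ * d)) :
    a * b = b * a ↔ c * d = d * c := by
  refine ⟨comm_congr h1 h2, comm_congr ?_ ?_⟩
  · simpa using Z_inv h1
  · simpa using Z_inv h2

lemma act_mem (f : MulAut G) : MulAction.toPermHom (MulAut G) S f ∈ K := by
  intro s t
  rw [rep_comm, rep_comm]
  refine or_congr ((MulAction.toPermHom (MulAut G) S f).injective.eq_iff).symm (not_congr ?_)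
  refine Iff.trans ?_ (comm_congr_iff (act_spec f s) (act_spec f t))
  rw [← map_mul, ← map_mul, f.injective.eq_iff]

/-- The action of `K` on the two blocks. -/
instance : MulAction K Bool where
  smul p b := (p.1 (b, 0)).1
  one_smul _ := rfl
  mul_smul p q b := (p.2 (q.1 (b, 0)) ((q.1 (b, 0)).1, 0)).1 rfl

abbrev blockHom : K →* Equiv.Perm Bool := MulAction.toPermHom K Bool

lemma ker_fst (p : blockHom.ker) (b : Bool) (i : Fin 3) : (p.1.1 (b, i)).1 = b :=
  ((p.1.2 (b, i) (b, 0)).1 rfl).trans (Equiv.congr_fun p.2 b)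

/-- The action of the kernel on one block. -/
def innerAct (b : Bool) : MulAction blockHom.ker (Fin 3) where
  smul p i := (p.1.1 (b, i)).2
  one_smul _ := rfl
  mul_smul p q i := by
    have h : q.1.1 (b, i) = (b, (q.1.1 (b, i)).2) := Prod.ext (ker_fst q b i) rfl
    exact congrArg (fun s => (p.1.1 s).2) h

def innerHom (b : Bool) : blockHom.ker →* Equiv.Perm (Fin 3) :=
  @MulAction.toPermHom _ _ _ (innerAct b)

lemma inner_inj : Function.Injective ((innerHom false).prod (innerHom true)) := by
  intro p q h
  have h' := Prod.ext_iff.1 h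
  refine Subtype.ext (Subtype.ext (Equiv.ext ?_))
  rintro ⟨b, i⟩
  refine Prod.ext ((ker_fst p b i).trans (ker_fst q b i).symm) ?_
  cases b
  · exact Equiv.congr_fun h'.1 i
  · exact Equiv.congr_fun h'.2 i

lemma card_K : Nat.card K ∣ 72 := by
  have h1 : Nat.card K = Nat.card blockHom.ker * Nat.card blockHom.range := by
    rw [← Subgroup.card_mul_index blockHom.ker, Subgroup.index_ker]
  have h2 : Nat.card blockHom.range ∣ 2 := by
    have h := Subgroup.card_subgroup_dvd_card blockHom.range
    rwa [Nat.card_perm, Nat.card_eq_fintype_card (α := Bool), Fintype.card_bool] at h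
  have h3 : Nat.card blockHom.ker ∣ 36 := by
    have h := Subgroup.card_dvd_of_injective _ inner_inj
    rwa [Nat.card_prod, Nat.card_perm, Nat.card_eq_fintype_card (α := Fin 3),
      Fintype.card_fin] at h
  rw [h1]
  exact mul_dvd_mul h3 h2

noncomputable def theta : MulAut G →* K := (MulAction.toPermHom (MulAut G) S).codRestrict K act_mem

/-- `f` acts trivially modulo the centre. -/
lemma Q_dec : ∀ g : Q, (Z g ∧ True) ∨ ∃ i, Z ((rep0 i)⁻¹ * g) := by decide

lemma Z_sq : ∀ g : Q, Z g → g * g = 1 := by decide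
lemma Z_is : ∀ g : Q, Z g → ∃ h, g = h * h := by decide

def triv (f : MulAut G) : Subgroup G where
  carrier := {g | Z (g⁻¹ * f g)}
  one_mem' := by simpa using Z_one
  mul_mem' := fun {a b} ha hb => by
    have : (a * b)⁻¹ * f (a * b) = (a⁻¹ * f a) * (b⁻¹ * f b) := by
      calc _ = b⁻¹ * ((a⁻¹ * f a) * f b) := by simp [mul_assoc]
        _ = b⁻¹ * (f b * (a⁻¹ * f a)) := by rw [ha (f b)]
        _ = (b⁻¹ * f b) * (a⁻¹ * f a) := by group
        _ = _ := hb _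
    show Z _
    rw [this]
    exact Z_mul ha hb
  inv_mem' := fun {a} ha => by
    have : (a⁻¹)⁻¹ * f a⁻¹ = (a⁻¹ * f a)⁻¹ := by
      have h := Z_inv ha a
      calc _ = a * (f a)⁻¹ := by simp
        _ = a * ((a⁻¹ * f a)⁻¹ * a⁻¹) := by simp
        _ = (a * (a⁻¹ * f a)⁻¹) * a⁻¹ := by group
        _ = _ := by rw [← h]; group
    show Z _
    rw [this]
    exact Z_inv ha

lemma triv_top {f : MulAut G} (hf : theta f = 1) : triv f = ⊤ := by
  have h0 : ∀ s, rep s ∈ triv f := fun s => by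
    have h1 : act f s = s := Equiv.congr_fun (congrArg Subtype.val hf) s
    have := Z_inv (act_spec f s)
    rw [h1] at this
    show Z _
    simpa using this
  have hZ : ∀ g, Z g → g ∈ triv f := fun g hg => Z_mul (Z_inv hg) (Z_map f hg)
  have hl : ∀ x : Q, ((x, 1) : G) ∈ triv f := fun x => by
    rcases Q_dec x with h | ⟨i, h⟩
    · exact hZ _ ((Z_prod _).2 ⟨h.1, Z_one⟩)
    · have := mul_mem (h0 (true, i)) (hZ ((rep0 i)⁻¹ * x, 1) ((Z_prod _).2 ⟨h, Z_one⟩))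
      simpa [rep] using this
  have hr : ∀ x : Q, ((1, x) : G) ∈ triv f := fun x => by
    rcases Q_dec x with h | ⟨i, h⟩
    · exact hZ _ ((Z_prod _).2 ⟨Z_one, h.1⟩)
    · have := mul_mem (h0 (false, i)) (hZ (1, (rep0 i)⁻¹ * x) ((Z_prod _).2 ⟨Z_one, h⟩))
      simpa [rep] using this
  rw [eq_top_iff]
  rintro ⟨x, y⟩ -
  simpa using mul_mem (hl x) (hr y)

lemma ker_sq {f : MulAut G} (hf : theta f = 1) : f ^ 2 = 1 := by
  have h : ∀ g, Z (g⁻¹ * f g) := fun g => by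
    have : g ∈ triv f := by rw [triv_top hf]; trivial
    exact this
  have zsq : ∀ z : G, Z z → z * z = 1 := fun z hz =>
    Prod.ext (Z_sq _ ((Z_prod _).1 hz).1) (Z_sq _ ((Z_prod _).1 hz).2)
  have fz : ∀ z : G, Z z → f z = z := fun z hz => by
    obtain ⟨a, ha⟩ := Z_is _ ((Z_prod _).1 hz).1
    obtain ⟨b, hb⟩ := Z_is _ ((Z_prod _).1 hz).2
    have e : z = (a, b) * (a, b) := Prod.ext ha hb
    generalize ((a, b) : G) = g at e
    have hg := h g
    have e2 : f g = g * (g⁻¹ * f g) := by group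
    generalize g⁻¹ * f g = w at hg e2
    rw [e, map_mul, e2]
    calc g * w * (g * w) = g * (w * g) * w := by group
      _ = g * g * (w * w) := by rw [hg]; group
      _ = _ := by rw [zsq w hg, mul_one]
  refine MulEquiv.ext fun g => ?_
  have hg := h g
  have e2 : f g = g * (g⁻¹ * f g) := by group
  generalize g⁻¹ * f g = w at hg e2
  rw [pow_two, MulAut.mul_apply, e2, map_mul, e2, fz w hg, mul_assoc, zsq w hg]
  simp

instance : Finite (MulAut G) := Finite.of_injective (fun f : MulAut G => (f : G → G))
  DFunLike.coe_injective

lemma card_B : Nat.card (Multiplicative (ZMod 3) × Multiplicative (ZMod 3)) = 9 := by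
  simp

lemma card_range : Nat.card psi.range = 9 := by
  rw [← card_B]
  exact (Nat.card_congr (MonoidHom.ofInjective psi_inj).toEquiv).symm

lemma card_A : ∃ a : ℕ, Nat.card (MulAut G) = 9 * 2 ^ a := by
  have hk : IsPGroup 2 theta.ker := fun f => ⟨1, Subtype.ext (ker_sq f.2)⟩
  obtain ⟨k, hk⟩ := (IsPGroup.iff_card (p := 2)).1 hk
  have h1 : Nat.card (MulAut G) = Nat.card theta.ker * Nat.card theta.range := by
    rw [← Subgroup.card_mul_index theta.ker, Subgroup.index_ker]
  have h2 : Nat.card theta.range ∣ 72 := (Subgroup.card_subgroup_dvd_card theta.range).trans card_K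
  have h3 : 9 ∣ Nat.card (MulAut G) := card_range ▸ Subgroup.card_subgroup_dvd_card psi.range
  have h4 : Nat.card (MulAut G) ∣ 9 * 2 ^ (k + 3) := by
    rw [h1, hk]
    have : 9 * 2 ^ (k + 3) = 2 ^ k * 72 := by ring
    rw [this]
    exact Nat.mul_dvd_mul_left _ h2
  obtain ⟨m, hm⟩ := h3
  rw [hm] at h4
  obtain ⟨a, -, ha⟩ := (Nat.dvd_prime_pow Nat.prime_two).1 (Nat.dvd_of_mul_dvd_mul_left (by norm_num) h4)
  exact ⟨a, by rw [hm, ha]⟩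

end QQ

/-- `Aut(Q8 × Q8)` is a `{2,3}`-group with Sylow 3-subgroup `C3 × C3`:
its order is `9 * 2 ^ a` for some `a`, and every Sylow 3-subgroup of it is isomorphic to
`C3 × C3`. -/
theorem stmt8 :
    (∃ a : ℕ, Nat.card (MulAut (QuaternionGroup 2 × QuaternionGroup 2)) = 9 * 2 ^ a) ∧
    ∀ P : Sylow 3 (MulAut (QuaternionGroup 2 × QuaternionGroup 2)),
      Nonempty ((P : Subgroup (MulAut (QuaternionGroup 2 × QuaternionGroup 2))) ≃*
        Multiplicative (ZMod 3) × Multiplicative (ZMod 3)) := by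
  refine ⟨QQ.card_A, fun P => ?_⟩
  obtain ⟨a, ha⟩ := QQ.card_A
  have : Fact (Nat.Prime 3) := ⟨Nat.prime_three⟩
  have hf : (9 * 2 ^ a).factorization 3 = 2 := by
    have h9 : (9 : ℕ) = 3 ^ 2 := by norm_num
    have h2 : (2 ^ a).factorization 3 = 0 := by
      apply Nat.factorization_eq_zero_of_not_dvd
      intro h
      have := Nat.prime_three.dvd_of_dvd_pow h
      omega
    rw [Nat.factorization_mul (by norm_num) (by positivity), Finsupp.add_apply, h2, h9,
      Nat.Prime.factorization_pow Nat.prime_three]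
    simp
  let R : Sylow 3 (MulAut QQ.G) := Sylow.ofCard QQ.psi.range (by
    rw [QQ.card_range, ha, hf]; norm_num)
  exact ⟨(Sylow.equiv P R).trans (MonoidHom.ofInjective QQ.psi_inj).symm⟩
end

section
/- The automorphism group Aut(C4 ⋊ Q8) is a 2-group, i.e., its order is a power of 2. -/
namespace Stmt10

abbrev C := Multiplicative (ZMod 4)
abbrev Q := QuaternionGroup 2

/-- The explicit action. -/
def act : Q → MulAut C
  | .a _ => 1
  | .xa _ => MulEquiv.inv C

def φ₀ : Q →* MulAut C where
  toFun := act
  map_one' := rfl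
  map_mul' := by
    rintro (x | x) (y | y) <;> ext t <;> simp [act, QuaternionGroup.a_mul_a, QuaternionGroup.a_mul_xa, QuaternionGroup.xa_mul_a, QuaternionGroup.xa_mul_xa]

theorem phi_eq (φ : Q →* MulAut C) (hi : φ (QuaternionGroup.a 1) = 1)
    (hj : φ (QuaternionGroup.xa 0) = MulEquiv.inv C) : φ = φ₀ := by
  have h1 : ∀ k : ZMod 4, φ (QuaternionGroup.a k) = 1 := by
    intro k
    have : (QuaternionGroup.a k : Q) = (QuaternionGroup.a 1) ^ k.val := by
      revert k; decide
    rw [this, map_pow, hi, one_pow]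
  ext1 g
  rcases g with k | k
  · exact h1 k
  · have : (QuaternionGroup.xa k : Q) = QuaternionGroup.xa 0 * QuaternionGroup.a k := by
      rw [QuaternionGroup.xa_mul_a, zero_add]
    rw [this, map_mul, h1, hj, mul_one, ← this]; rfl

abbrev G := C ⋊[φ₀] Q

instance : DecidableEq G := fun x y =>
  decidable_of_iff (x.left = y.left ∧ x.right = y.right) SemidirectProduct.ext_iff.symm

instance : Fintype G := Fintype.ofEquiv (C × Q) SemidirectProduct.equivProd.symm

/-- Membership in the abelian subgroup of index two. -/
def InA (g : G) : Prop := ∀ h : G, h * g = g * h ∨ h * g = g⁻¹ * h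

def InX (g : G) : Prop := InA g ∧ ∃ h, ¬ InA h ∧ g * g = h * h

def InY (g : G) : Prop := InA g ∧ ¬ InX g ∧ g * g ≠ 1

def bA : G → Bool
  | ⟨_, .a _⟩ => true
  | ⟨_, .xa _⟩ => false

def gc : G := ⟨.ofAdd 1, 1⟩
def gi : G := ⟨1, .a 1⟩
def gj : G := ⟨1, .xa 0⟩

set_option maxRecDepth 100000

theorem inA_iff : ∀ g, InA g ↔ bA g = true := by
  unfold InA; decide +kernel

theorem inX_iff (g : G) : InX g ↔ (bA g = true ∧ g * g = gi * gi) := by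
  have : ∀ h : G, ¬ bA h = true → h * h = gi * gi := by decide +kernel
  have hj : ¬ bA gj = true := by decide +kernel
  simp only [InX, inA_iff]
  constructor
  · rintro ⟨h, k, hk, e⟩
    exact ⟨h, e.trans (this k hk)⟩
  · rintro ⟨h, e⟩
    exact ⟨h, gj, hj, e.trans (this gj hj).symm⟩

theorem inY_iff (g : G) : InY g ↔ (bA g = true ∧ g * g ≠ gi * gi ∧ g * g ≠ 1) := by
  simp only [InY, inX_iff, inA_iff]; tauto

theorem inA_map (f : MulAut G) (g : G) : InA (f g) ↔ InA g := by
  unfold InA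
  rw [← f.toEquiv.forall_congr_right]
  simp only [MulEquiv.toEquiv_eq_coe, MulEquiv.coe_toEquiv, ← map_mul, ← map_inv, f.injective.eq_iff]

theorem inX_map (f : MulAut G) (g : G) : InX (f g) ↔ InX g := by
  unfold InX
  rw [← f.toEquiv.exists_congr_right]
  simp only [MulEquiv.toEquiv_eq_coe, MulEquiv.coe_toEquiv, ← map_mul, f.injective.eq_iff, inA_map]

theorem inY_map (f : MulAut G) (g : G) : InY (f g) ↔ InY g := by
  unfold InY
  simp only [← map_mul, inA_map, inX_map, ne_eq, map_eq_one_iff f f.injective]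

theorem gen1 : ∀ x : G, (bA x = true ∧ x * x = gi * gi) →
    ∀ y : G, (bA y = true ∧ y * y ≠ gi * gi ∧ y * y ≠ 1) →
    (∃ m n : Fin 4, gi = x ^ m.val * y ^ n.val) ∧ (∃ m n : Fin 4, gc = x ^ m.val * y ^ n.val) := by
  decide +kernel

theorem gen2 : ∀ w : G, ¬ bA w = true → ∃ m n : Fin 4, gj = gc ^ m.val * gi ^ n.val * w := by
  decide +kernel

theorem gen3 : ∀ g : G, ∃ m n : Fin 4, ∃ k : Fin 2,
    g = gc ^ m.val * gi ^ n.val * gj ^ k.val := by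
  decide +kernel

theorem fixed (f : MulAut G) (p : ℕ) (hp : p.Prime) (hf : f ^ p = 1) (P : G → Prop)
    (hP : ∀ g, P (f g) ↔ P g) (k : ℕ) (hk : Nat.card {g // P g} = 2 ^ k) (h2 : p ≠ 2) :
    ∃ g, P g ∧ f g = g := by
  classical
  have := Fact.mk hp
  let σ : Equiv.Perm {g // P g} := Equiv.Perm.subtypePerm f.toEquiv hP
  have hpow : ∀ (n : ℕ) (g : {g // P g}), (((σ ^ n) g : {g // P g}) : G) = (f ^ n) g := by
    intro n
    induction n with
    | zero => intro g; rfl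
    | succ n ih => intro g; rw [pow_succ, pow_succ, Equiv.Perm.mul_apply, ih]; rfl
  have hσ : σ ^ p ^ 1 = 1 := by
    refine Equiv.ext fun g => Subtype.ext ?_
    rw [pow_one, hpow, hf]; rfl
  have hd : ¬ p ∣ Fintype.card {g // P g} := by
    rw [← Nat.card_eq_fintype_card, hk]
    intro h
    exact h2 ((Nat.prime_dvd_prime_iff_eq hp Nat.prime_two).1 (hp.dvd_of_dvd_pow h))
  obtain ⟨a, ha⟩ := Equiv.Perm.exists_fixed_point_of_prime hd hσ
  exact ⟨a, a.2, congrArg Subtype.val ha⟩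

theorem cardX : Nat.card {g // InX g} = 2 ^ 2 := by
  simp only [inX_iff]; rw [Nat.card_eq_fintype_card]; decide +kernel

theorem cardY : Nat.card {g // InY g} = 2 ^ 3 := by
  simp only [inY_iff]; rw [Nat.card_eq_fintype_card]; decide +kernel

theorem cardW : Nat.card {g // ¬ InA g} = 2 ^ 4 := by
  simp only [inA_iff]; rw [Nat.card_eq_fintype_card]; decide +kernel

theorem odd_trivial (f : MulAut G) (p : ℕ) (hp : p.Prime) (hf : f ^ p = 1) (h2 : p ≠ 2) :
    f = 1 := by
  obtain ⟨x, hx, fx⟩ := fixed f p hp hf InX (inX_map f) 2 cardX h2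
  obtain ⟨y, hy, fy⟩ := fixed f p hp hf InY (inY_map f) 3 cardY h2
  obtain ⟨w, hw, fw⟩ := fixed f p hp hf (fun g => ¬ InA g)
    (fun g => not_congr (inA_map f g)) 4 cardW h2
  obtain ⟨⟨m, n, h⟩, ⟨m', n', h'⟩⟩ := gen1 x ((inX_iff x).1 hx) y ((inY_iff y).1 hy)
  have fi : f gi = gi := by rw [h, map_mul, map_pow, map_pow, fx, fy]
  have fc : f gc = gc := by rw [h', map_mul, map_pow, map_pow, fx, fy]
  obtain ⟨a, b, hab⟩ := gen2 w (fun h => hw ((inA_iff w).2 h))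
  have fj : f gj = gj := by rw [hab, map_mul, map_mul, map_pow, map_pow, fi, fc, fw]
  ext1 g
  obtain ⟨a, b, k, e⟩ := gen3 g
  rw [e, map_mul, map_mul, map_pow, map_pow, map_pow, fi, fc, fj]; rfl

theorem main : ∃ k : ℕ, Nat.card (MulAut G) = 2 ^ k := by
  have : Finite (MulAut G) := Finite.of_injective (fun f : MulAut G => (f : G → G))
    DFunLike.coe_injective
  refine ⟨_, Nat.eq_prime_pow_of_unique_prime_dvd Nat.card_pos.ne' ?_⟩
  intro p hp hd
  by_contra h2
  have := Fact.mk hp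
  obtain ⟨f, hf⟩ := exists_prime_orderOf_dvd_card' p hd
  have := odd_trivial f p hp (hf ▸ pow_orderOf_eq_one f) h2
  rw [this, orderOf_one] at hf
  exact hp.one_lt.ne hf

end Stmt10

/-- The automorphism group of `C4 ⋊ Q8` (where `i ∈ Q8` acts trivially
on `C4` and `j` acts by inversion) is a 2-group: its order is a power of 2. -/
theorem stmt10 (φ : QuaternionGroup 2 →* MulAut (Multiplicative (ZMod 4)))
    (hi : φ (QuaternionGroup.a 1) = 1)
    (hj : φ (QuaternionGroup.xa 0) = MulEquiv.inv (Multiplicative (ZMod 4))) :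
    ∃ k : ℕ,
      Nat.card (MulAut ((Multiplicative (ZMod 4)) ⋊[φ] (QuaternionGroup 2))) = 2 ^ k := by
  obtain rfl := Stmt10.phi_eq φ hi hj
  exact Stmt10.main
end

section
/- Let G be a finite solvable group whose Sylow 2-subgroups are isomorphic to the quaternion group Q8 of order 8. Then G has 2-length one: there exist subgroups N ≤ M of G, both normal in G, such that N has odd order, the quotient M/N is a 2-group, and the index [G:M] is odd. -/
set_option linter.unusedVariables false
section
open Subgroup
theorem q8_cyclic (R : Subgroup (QuaternionGroup 2)) (h : Nat.card R ≤ 4) : IsCyclic R := by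
  have hA : ∀ x : QuaternionGroup 2, x ^ 2 = 1 → x = 1 ∨ x = QuaternionGroup.a 2 := by decide
  have hB : ∀ x : QuaternionGroup 2, x ^ 4 = 1 := by decide
  by_cases hx : ∃ x ∈ R, x ^ 2 ≠ 1
  · obtain ⟨x, hxR, hx⟩ := hx
    have h4 : orderOf x = 2 ^ (1 + 1) := by
      have : Fact (Nat.Prime 2) := ⟨Nat.prime_two⟩
      exact orderOf_eq_prime_pow (by simpa using hx) (by simpa using hB x)
    have : zpowers x = R := by
      apply Subgroup.eq_of_le_of_card_ge (by simpa using hxR)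
      rw [Nat.card_zpowers, h4]
      exact h
    rw [← this]
    infer_instance
  · push Not at hx
    have hle : R ≤ zpowers (QuaternionGroup.a 2 : QuaternionGroup 2) := by
      intro x hxR
      rcases hA x (hx x hxR) with rfl | rfl
      · exact one_mem _
      · exact mem_zpowers _
    exact isCyclic_of_injective (Subgroup.inclusion hle) (Subgroup.inclusion_injective hle)

theorem aux_nilp {D : Type*} [Group D] (h : commutator D ≤ center D) : Group.IsNilpotent D := by
  apply Group.of_quotient_center_nilpotent
  have := Subgroup.Normal.quotient_commutative_iff_commutator_le.mpr h
  let _ : CommGroup (D ⧸ center D) := { (inferInstance : Group (D ⧸ center D)) with mul_comm := this.1.1 }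
  exact CommGroup.isNilpotent

theorem aux_nilp2 {H : Type*} [Group H] [Finite H]
    (hodd : ∀ K : Subgroup H, K.Normal → Odd (Nat.card K) → K = ⊥)
    (D : Subgroup H) [D.Normal] [Group.IsNilpotent D] : IsPGroup 2 D := by
  rw [IsPGroup.iff_card]
  refine ⟨_, Nat.eq_prime_pow_of_unique_prime_dvd (Nat.card_pos.ne') ?_⟩
  intro p hp hpd
  by_contra hne
  have : Fact p.Prime := ⟨hp⟩
  obtain ⟨S⟩ : Nonempty (Sylow p D) := inferInstance
  have := S.characteristic_of_normal inferInstance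
  have h1 : ((S : Subgroup D).map D.subtype) = ⊥ := by
    apply hodd _ inferInstance
    rw [Subgroup.card_map_of_injective D.subtype_injective]
    obtain ⟨k, hk⟩ := S.2.exists_card_eq
    change Nat.card (S : Subgroup D) = _ at hk
    rw [hk]
    exact (hp.odd_of_ne_two hne).pow
  have h2 := S.dvd_card_of_dvd_card hpd
  rw [← Subgroup.card_map_of_injective D.subtype_injective, h1] at h2
  simp at h2
  exact hp.one_lt.ne' h2

theorem aux_cent {H : Type*} [Group H] [Finite H] (hs : Group.IsSolvable H)
    (hodd : ∀ K : Subgroup H, K.Normal → Odd (Nat.card K) → K = ⊥)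
    (R : Subgroup H) [R.Normal]
    (hmax : ∀ K : Subgroup H, K.Normal → IsPGroup 2 K → K ≤ R) :
    centralizer (R : Set H) ≤ R := by
  set C := centralizer (R : Set H) with hC
  have hex : ∃ n, (derivedSeries C n).map C.subtype ≤ R := by
    obtain ⟨n, hn⟩ := (inferInstance : Group.IsSolvable C)
    exact ⟨n, by simp [hn]⟩
  classical
  have hn := Nat.find_spec hex
  rcases h : Nat.find hex with _ | n
  · rw [h] at hn
    rwa [derivedSeries_zero, ← MonoidHom.range_eq_map, range_subtype] at hn
  · exfalso
    apply Nat.find_min hex (m := n) (by omega)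
    rw [h, derivedSeries_succ, map_commutator] at hn
    set D := (derivedSeries C n).map C.subtype with hD
    have : D.Normal := inferInstance
    have hDC : D ≤ C := map_subtype_le _
    have : Group.IsNilpotent D := by
      apply aux_nilp
      rw [_root_.commutator_def, commutator_le]
      rintro x - y -
      rw [mem_center_iff]
      intro z
      have h1 : (x : H) * y * (x : H)⁻¹ * (y : H)⁻¹ ∈ R := hn (commutator_mem_commutator x.2 y.2)
      have h2 := mem_centralizer_iff.mp (hDC z.2) _ h1
      ext
      exact h2.symm
    exact hmax D inferInstance (aux_nilp2 hodd D)

theorem aux_main {H : Type*} [Group H] [Finite H] (hs : Group.IsSolvable H)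
    (hodd : ∀ K : Subgroup H, K.Normal → Odd (Nat.card K) → K = ⊥)
    (hQ8 : ∀ P : Sylow 2 H, Nonempty ((P : Subgroup H) ≃* QuaternionGroup 2)) :
    ∃ R : Subgroup H, R.Normal ∧ IsPGroup 2 R ∧ Odd R.index := by
  obtain ⟨R, ⟨hRn, hRp⟩, hRm⟩ := (Set.toFinite {K : Subgroup H | K.Normal ∧ IsPGroup 2 K}).exists_maximal
    ⟨⊥, inferInstance, IsPGroup.of_bot⟩
  have hmax : ∀ K : Subgroup H, K.Normal → IsPGroup 2 K → K ≤ R := fun K hK hKp =>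
    le_sup_right.trans (hRm (y := R ⊔ K) ⟨inferInstance, hRp.to_sup_of_normal_right hKp⟩ le_sup_left)
  have hcent := aux_cent hs hodd R hmax
  obtain ⟨P, hRP⟩ := hRp.exists_le_sylow
  obtain ⟨e⟩ := hQ8 P
  have hP8 : Nat.card P = 8 := by
    rw [Nat.card_congr e.toEquiv, Nat.card_eq_fintype_card, QuaternionGroup.card]
  have hPi : Odd (P : Subgroup H).index := by
    rw [← Nat.not_even_iff_odd, even_iff_two_dvd]
    exact P.not_dvd_index
  refine ⟨R, hRn, hRp, ?_⟩
  by_cases hRP' : R = P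
  · rwa [hRP']
  exfalso
  have hdvd : Nat.card R ∣ 8 := hP8 ▸ Subgroup.card_dvd_of_le hRP
  have hne : Nat.card R ≠ 8 := fun h8 => hRP' (Subgroup.eq_of_le_of_card_ge hRP (by
    rw [h8]; exact hP8.le))
  have hle : Nat.card R ≤ 4 := by
    have : Nat.card R ≤ 8 := Nat.le_of_dvd (by norm_num) hdvd
    interval_cases Nat.card R <;> omega
  have hcyc : IsCyclic R := by
    let f : R →* QuaternionGroup 2 := e.toMonoidHom.comp (Subgroup.inclusion hRP)
    have hf : Function.Injective f := e.injective.comp (Subgroup.inclusion_injective hRP)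
    let e' := MonoidHom.ofInjective hf
    have := q8_cyclic f.range (by rwa [← Nat.card_congr e'.toEquiv])
    exact isCyclic_of_surjective e'.symm e'.symm.surjective
  have hker : (MulAut.conjNormal (H := R)).ker ≤ R := by
    refine le_trans ?_ hcent
    intro g hg
    rw [mem_centralizer_iff]
    intro r hr
    have := congrArg (fun φ : MulAut R => ((φ ⟨r, hr⟩ : R) : H)) (MonoidHom.mem_ker.mp hg)
    simp only [MulAut.conjNormal_apply, MulAut.one_apply] at this
    rw [mul_inv_eq_iff_eq_mul] at this
    exact this.symm
  have hcard : Nat.card H ≤ 8 := by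
    have h1 := (MulAut.conjNormal (H := R)).ker.card_mul_index
    rw [Subgroup.index_ker] at h1
    have h2 : Nat.card (MulAut.conjNormal (H := R)).range ≤ 2 := by
      refine (Nat.card_le_card_of_injective _ (Subgroup.subtype_injective _)).trans ?_
      rw [IsCyclic.card_mulAut]
      have : 0 < Nat.card R := Nat.card_pos
      interval_cases Nat.card R <;> decide
    have h3 : Nat.card (MulAut.conjNormal (H := R)).ker ≤ 4 :=
      (Nat.card_le_card_of_injective _ (Subgroup.inclusion_injective hker)).trans hle
    nlinarith
  have hPtop : (P : Subgroup H) = ⊤ := Subgroup.eq_top_of_le_card _ (hcard.trans hP8.ge)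
  have : (P : Subgroup H) ≤ R := hmax P (by rw [hPtop]; infer_instance) P.2
  exact hRP' (le_antisymm hRP this)
end

/-- A finite solvable group whose Sylow 2-subgroups are isomorphic to
the quaternion group `Q8` has 2-length one: there are normal subgroups `N ≤ M` of `G`
with `|N|` odd, `M/N` a 2-group, and `[G:M]` odd. -/
theorem stmt12 (G : Type*) [Group G] [Fintype G] (hsolv : IsSolvable G)
    (hQ8 : ∀ P : Sylow 2 G, Nonempty ((P : Subgroup G) ≃* QuaternionGroup 2)) :
    ∃ N M : Subgroup G, N.Normal ∧ M.Normal ∧ N ≤ M ∧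
      Odd (Nat.card N) ∧ Odd M.index ∧
      ∃ k : ℕ, Nat.card (M ⧸ N.subgroupOf M) = 2 ^ k := by
  have hsolv' : Group.IsSolvable G := hsolv
  obtain ⟨N, ⟨hNn, hNo⟩, hNm⟩ := (Set.toFinite
    {K : Subgroup G | K.Normal ∧ Odd (Nat.card K)}).exists_maximal ⟨⊥, inferInstance, by simp⟩
  have hcm : ∀ K : Subgroup (G ⧸ N), Nat.card (K.comap (QuotientGroup.mk' N)) =
      Nat.card N * Nat.card K := by
    intro K
    have h1 := (K.comap (QuotientGroup.mk' N)).card_mul_index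
    rw [Subgroup.index_comap_of_surjective _ (QuotientGroup.mk'_surjective N)] at h1
    have h2 := K.card_mul_index
    have h3 := N.card_mul_index
    rw [Subgroup.index_eq_card] at h3
    rw [← h3, ← h2, ← mul_assoc] at h1
    exact Nat.eq_of_mul_eq_mul_right (Nat.pos_of_ne_zero K.index_ne_zero_of_finite) h1
  have hodd : ∀ K : Subgroup (G ⧸ N), K.Normal → Odd (Nat.card K) → K = ⊥ := by
    intro K hK hKo
    have h1 : N ≤ K.comap (QuotientGroup.mk' N) := QuotientGroup.le_comap_mk' N K
    have h2 := hNm (y := K.comap (QuotientGroup.mk' N))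
      ⟨inferInstance, by rw [hcm]; exact hNo.mul hKo⟩ h1
    rw [eq_bot_iff, ← Subgroup.map_comap_eq_self_of_surjective (QuotientGroup.mk'_surjective N) K]
    rw [Subgroup.map_le_iff_le_comap]
    refine h2.trans ?_
    rw [MonoidHom.comap_bot, QuotientGroup.ker_mk']
  have hq : ∀ P : Sylow 2 (G ⧸ N), Nonempty ((P : Subgroup (G ⧸ N)) ≃* QuaternionGroup 2) := by
    intro P
    obtain ⟨Q, rfl⟩ := Sylow.mapSurjective_surjective (QuotientGroup.mk'_surjective N) 2 P
    obtain ⟨e⟩ := hQ8 Q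
    rw [Sylow.coe_mapSurjective]
    have hinj : Function.Injective ((QuotientGroup.mk' N).comp (Q : Subgroup G).subtype) := by
      rw [injective_iff_map_eq_one]
      intro x hx
      have hxN : (x : G) ∈ N := (QuotientGroup.eq_one_iff _).mp hx
      have hcop : (Nat.card Q).Coprime (Nat.card N) := by
        obtain ⟨k, hk⟩ := IsPGroup.iff_card.mp Q.2
        change Nat.card Q = _ at hk
        rw [hk]
        exact (Nat.coprime_two_left.mpr hNo).pow_left k
      have := Subgroup.disjoint_def.mp (Subgroup.disjoint_of_coprime_natCard hcop) x.2 hxN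
      exact Subtype.ext this
    have e1 := MonoidHom.ofInjective hinj
    have e2 : ((QuotientGroup.mk' N).comp (Q : Subgroup G).subtype).range =
      (Q : Subgroup G).map (QuotientGroup.mk' N) := by
      rw [MonoidHom.range_comp, Subgroup.range_subtype]
    exact ⟨(MulEquiv.subgroupCongr e2).symm.trans (e1.symm.trans e)⟩
  obtain ⟨R, hRn, hRp, hRi⟩ := aux_main (inferInstance : Group.IsSolvable (G ⧸ N)) hodd hq
  have hle : N ≤ R.comap (QuotientGroup.mk' N) := QuotientGroup.le_comap_mk' N R
  refine ⟨N, R.comap (QuotientGroup.mk' N), hNn, inferInstance, hle, hNo, ?_, ?_⟩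
  · rwa [Subgroup.index_comap_of_surjective _ (QuotientGroup.mk'_surjective N)]
  · obtain ⟨k, hk⟩ := IsPGroup.iff_card.mp hRp
    refine ⟨k, ?_⟩
    rw [← hk, ← Subgroup.index_eq_card]
    have h1 := Subgroup.card_mul_index (N.subgroupOf (R.comap (QuotientGroup.mk' N)))
    rw [hcm, Nat.card_congr (Subgroup.subgroupOfEquivOfLe hle).toEquiv] at h1
    exact Nat.eq_of_mul_eq_mul_left Nat.card_pos h1
end
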